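/- A signed permutation w ∈ S_n^D is boolean (its principal Bruhat order ideal B(w) in the Bruhat order of S_n^D is order-isomorphic to a boolean lattice of subsets) if and only if w avoids all twenty of the following signed patterns (written in one-line notation, with negative entries indicated by a minus sign): (−1)(−2)(−3); (−1)(−3)(−2); (−2)(−1)(−3); (−2)(−3)(−1); (−3)(−1)(−2); (−3)(−2)(−1); 3 2 1; 3 4 1 2; 3 2 (−1); 3 (−1) (−2); 3 4 (−1) 2; 3 4 (−2) (−1); (−3) 2 1; (−2) (−3) 1; (−3) 4 1 2; (−4) (−3) 1 2; 1 (−2); 3 (−2) 1; (−3) 2 (−1); (−3) 4 (−1) 2. (Some of these patterns have an odd number of negative values and hence do not themselves lie in a type D group.) -/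

import Mathlib

namespace Paper

/-! ### Type A: the symmetric group `S_n` as `Equiv.Perm (Fin n)` -/

/-- The simple transposition `s_i ∈ S_n` (1-indexed letter `i`, meaningful for
`1 ≤ i ≤ n-1`): it interchanges the entries in (1-indexed) positions `i` and `i+1`,
i.e. (0-indexed) positions `i-1` and `i` of `Fin n`. Out-of-range letters give `1`. -/
def sA (n : ℕ) (i : ℕ) : Equiv.Perm (Fin n) :=
  if h : 1 ≤ i ∧ i < n then Equiv.swap ⟨i - 1, by omega⟩ ⟨i, h.2⟩ else 1

/-- The product `s_{i_1} ⋯ s_{i_ℓ}` of a word `i_1 ⋯ i_ℓ`. -/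
def prodA (n : ℕ) (w : List ℕ) : Equiv.Perm (Fin n) := (w.map (sA n)).prod

/-- A word in the letters `{1, …, n-1}`. -/
def IsWordA (n : ℕ) (w : List ℕ) : Prop := ∀ i ∈ w, 1 ≤ i ∧ i ≤ n - 1

/-- `w` is a reduced decomposition of `x ∈ S_n`. -/
def ReducedA (n : ℕ) (w : List ℕ) (x : Equiv.Perm (Fin n)) : Prop :=
  IsWordA n w ∧ prodA n w = x ∧
    ∀ w' : List ℕ, IsWordA n w' → prodA n w' = x → w.length ≤ w'.length

/-- The Coxeter length `ℓ(x)`: minimal length of a word for `x`. -/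
noncomputable def lenA (n : ℕ) (x : Equiv.Perm (Fin n)) : ℕ :=
  sInf {l | ∃ w : List ℕ, IsWordA n w ∧ prodA n w = x ∧ w.length = l}

/-- Bruhat order on `S_n`: `v ≤ w` iff some reduced decomposition of `v` is a
(not necessarily consecutive) subword of some reduced decomposition of `w`. -/
def bruhatA (n : ℕ) (v w : Equiv.Perm (Fin n)) : Prop :=
  ∃ a b : List ℕ, ReducedA n a v ∧ ReducedA n b w ∧ a.Sublist b

/-- `w ∈ S_n` is boolean: the principal order ideal `B(w)`, ordered by the Bruhat
order, is order-isomorphic to the lattice of all subsets of `{1,…,r}` for some `r`. -/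
def BooleanA (n : ℕ) (w : Equiv.Perm (Fin n)) : Prop :=
  ∃ (r : ℕ) (e : {v : Equiv.Perm (Fin n) // bruhatA n v w} ≃ Finset (Fin r)),
    ∀ a b : {v : Equiv.Perm (Fin n) // bruhatA n v w}, bruhatA n a.1 b.1 ↔ e a ⊆ e b

/-- Pattern containment: `w ∈ S_n` contains `p ∈ S_k`. -/
def ContainsA {n k : ℕ} (w : Equiv.Perm (Fin n)) (p : Equiv.Perm (Fin k)) : Prop :=
  ∃ f : Fin k → Fin n, StrictMono f ∧ ∀ a b : Fin k, w (f a) < w (f b) ↔ p a < p b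

/-- Pattern avoidance. -/
def AvoidsA {n k : ℕ} (w : Equiv.Perm (Fin n)) (p : Equiv.Perm (Fin k)) : Prop :=
  ¬ ContainsA w p

/-- The pattern `321` (one-line notation). -/
def p321 : Equiv.Perm (Fin 3) := ⟨![2,1,0], ![2,1,0], by decide, by decide⟩
/-- The pattern `231` (one-line notation). -/
def p231 : Equiv.Perm (Fin 3) := ⟨![1,2,0], ![2,0,1], by decide, by decide⟩
/-- The pattern `312` (one-line notation). -/
def p312 : Equiv.Perm (Fin 3) := ⟨![2,0,1], ![1,2,0], by decide, by decide⟩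
/-- The pattern `3412` (one-line notation). -/
def p3412 : Equiv.Perm (Fin 4) := ⟨![2,3,0,1], ![2,3,0,1], by decide, by decide⟩

/-- The longest (decreasing) permutation `w_0^{(k)} = k (k-1) ⋯ 2 1 ∈ S_k`. -/
def w0 (k : ℕ) : Equiv.Perm (Fin k) := Fin.revPerm

/-- The shift of a word by `M`: each letter `i` becomes `i + M`. -/
def shift (M : ℕ) (w : List ℕ) : List ℕ := w.map (· + M)




/-! ### Types B and D: signed permutations, modelled as permutations `w` of `ℤ`
with `w(-x) = -w(x)` that fix all integers of absolute value `> n`. -/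

/-- The simple generators of `S_n^B`, as permutations of `ℤ`:
`sB 0` negates the value `1`; for `i ≥ 1`, `sB i` interchanges the values
`i` and `i+1` (and `-i` and `-(i+1)`). -/
def sB : ℕ → Equiv.Perm ℤ
  | 0 => Equiv.swap 1 (-1)
  | (i+1) => Equiv.swap ((i : ℤ) + 1) ((i : ℤ) + 2) * Equiv.swap (-((i : ℤ) + 1)) (-((i : ℤ) + 2))

/-- The simple generators of `S_n^D`: letter `0` encodes `s_{1'} = s_0 s_1 s_0`
(mapping `1 ↦ -2` and `2 ↦ -1`), and letters `i ≥ 1` are as in type `B`. -/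
def sD : ℕ → Equiv.Perm ℤ
  | 0 => sB 0 * sB 1 * sB 0
  | (i+1) => sB (i+1)

def prodB (w : List ℕ) : Equiv.Perm ℤ := (w.map sB).prod
def prodD (w : List ℕ) : Equiv.Perm ℤ := (w.map sD).prod

/-- A word in the type `B`/`D` letters `{0, 1, …, n-1}`. -/
def IsWordBD (n : ℕ) (w : List ℕ) : Prop := ∀ i ∈ w, i ≤ n - 1

/-- `w` is a reduced decomposition of `x ∈ S_n^B`. -/
def ReducedB (n : ℕ) (w : List ℕ) (x : Equiv.Perm ℤ) : Prop :=
  IsWordBD n w ∧ prodB w = x ∧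
    ∀ w' : List ℕ, IsWordBD n w' → prodB w' = x → w.length ≤ w'.length

/-- `w` is a reduced decomposition of `x ∈ S_n^D`. -/
def ReducedD (n : ℕ) (w : List ℕ) (x : Equiv.Perm ℤ) : Prop :=
  IsWordBD n w ∧ prodD w = x ∧
    ∀ w' : List ℕ, IsWordBD n w' → prodD w' = x → w.length ≤ w'.length

/-- Length in `S_n^B`. -/
noncomputable def lenB (n : ℕ) (x : Equiv.Perm ℤ) : ℕ :=
  sInf {l | ∃ w : List ℕ, IsWordBD n w ∧ prodB w = x ∧ w.length = l}

/-- Length in `S_n^D`. -/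
noncomputable def lenD (n : ℕ) (x : Equiv.Perm ℤ) : ℕ :=
  sInf {l | ∃ w : List ℕ, IsWordBD n w ∧ prodD w = x ∧ w.length = l}

/-- Bruhat order on `S_n^B`. -/
def bruhatB (n : ℕ) (v w : Equiv.Perm ℤ) : Prop :=
  ∃ a b : List ℕ, ReducedB n a v ∧ ReducedB n b w ∧ a.Sublist b

/-- Bruhat order on `S_n^D`. -/
def bruhatD (n : ℕ) (v w : Equiv.Perm ℤ) : Prop :=
  ∃ a b : List ℕ, ReducedD n a v ∧ ReducedD n b w ∧ a.Sublist b

/-- `w` is an element of `S_n^B`: an "odd" permutation of `{±1, …, ±n}`. -/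
def IsSignedPerm (n : ℕ) (w : Equiv.Perm ℤ) : Prop :=
  (∀ x : ℤ, w (-x) = - w x) ∧ ∀ x : ℤ, (n : ℤ) < |x| → w x = x

/-- `w` is an element of `S_n^D`: a signed permutation with an even number of
negative values in its one-line notation. -/
def IsTypeD (n : ℕ) (w : Equiv.Perm ℤ) : Prop :=
  IsSignedPerm n w ∧ Even (((Finset.Icc (1 : ℤ) n).filter (fun x => w x < 0)).card)

/-- `w ∈ S_n^B` is boolean (for the type `B` Bruhat order). -/
def BooleanB (n : ℕ) (w : Equiv.Perm ℤ) : Prop :=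
  ∃ (r : ℕ) (e : {v : Equiv.Perm ℤ // bruhatB n v w} ≃ Finset (Fin r)),
    ∀ a b : {v : Equiv.Perm ℤ // bruhatB n v w}, bruhatB n a.1 b.1 ↔ e a ⊆ e b

/-- `w ∈ S_n^D` is boolean (for the type `D` Bruhat order). -/
def BooleanD (n : ℕ) (w : Equiv.Perm ℤ) : Prop :=
  ∃ (r : ℕ) (e : {v : Equiv.Perm ℤ // bruhatD n v w} ≃ Finset (Fin r)),
    ∀ a b : {v : Equiv.Perm ℤ // bruhatD n v w}, bruhatD n a.1 b.1 ↔ e a ⊆ e b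

/-- Signed pattern containment, where the pattern is given by its one-line
notation `p` (a list of nonzero integers): there are positions
`1 ≤ f 0 < ⋯ < f (k-1) ≤ n` such that each `w (f j)` has the same sign as the
`j`-th entry of `p`, and the absolute values appear in the same relative order. -/
def containsPat (n : ℕ) (w : Equiv.Perm ℤ) (p : List ℤ) : Prop :=
  ∃ f : Fin p.length → ℤ, StrictMono f ∧ (∀ j, 1 ≤ f j ∧ f j ≤ (n : ℤ)) ∧
    (∀ j, 0 < w (f j) ↔ 0 < p.get j) ∧
    (∀ j j', |w (f j)| < |w (f j')| ↔ |p.get j| < |p.get j'|)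

/-- Signed pattern avoidance. -/
def avoidsPat (n : ℕ) (w : Equiv.Perm ℤ) (p : List ℤ) : Prop := ¬ containsPat n w p


/-! ### Extra definitions used in some statements -/

/-- `w ∈ S_n` is decomposable: `B(w) ≅ B(u) × B(v)` (as posets under Bruhat order)
for some `u ∈ S_m`, `v ∈ S_{m'}` with `m, m' < n`. -/
def Decomposable (n : ℕ) (w : Equiv.Perm (Fin n)) : Prop :=
  ∃ (m m' : ℕ), m < n ∧ m' < n ∧
    ∃ (u : Equiv.Perm (Fin m)) (v : Equiv.Perm (Fin m'))
      (e : {x : Equiv.Perm (Fin n) // bruhatA n x w} ≃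
        {y : Equiv.Perm (Fin m) // bruhatA m y u} × {z : Equiv.Perm (Fin m') // bruhatA m' z v}),
      ∀ a b : {x : Equiv.Perm (Fin n) // bruhatA n x w},
        bruhatA n a.1 b.1 ↔
          (bruhatA m ((e a).1).1 ((e b).1).1 ∧ bruhatA m' ((e a).2).1 ((e b).2).1)

/-- `w` is decreasing on the set of positions `T`. -/
def DecrOn (n : ℕ) (w : Equiv.Perm (Fin n)) (T : Finset (Fin n)) : Prop :=
  ∀ a ∈ T, ∀ b ∈ T, a < b → w b < w a

/-- Every inversion of `w` lies in exactly one occurrence of the decreasing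
pattern `w_0^{(k)}`: for every `i < j` with `w i > w j` there is exactly one
`k`-element set of positions containing `i` and `j` on which `w` is decreasing. -/
def EveryInvOnce (n k : ℕ) (w : Equiv.Perm (Fin n)) : Prop :=
  ∀ i j : Fin n, i < j → w j < w i →
    ∃! T : Finset (Fin n), T.card = k ∧ DecrOn n w T ∧ i ∈ T ∧ j ∈ T

/-- Equality of two patterns of (possibly a priori different) sizes. -/
def EqPat {k m : ℕ} (p : Equiv.Perm (Fin k)) (q : Equiv.Perm (Fin m)) : Prop :=
  ∃ h : k = m, ∀ i : Fin k, ((p i : ℕ) = (q (Fin.cast h i) : ℕ))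

/-- `L(n,k)`: the number of boolean permutations in `S_n` of length `k`. -/
noncomputable def LA (n k : ℕ) : ℕ :=
  Nat.card {w : Equiv.Perm (Fin n) // BooleanA n w ∧ lenA n w = k}

/-- `L` extended to integer arguments, with the convention that it vanishes
when `m < 1` or `j < 0`. -/
noncomputable def Lz (m j : ℤ) : ℤ :=
  if 1 ≤ m ∧ 0 ≤ j then (LA m.toNat j.toNat : ℤ) else 0

/-- `L^D(n,k)`: the number of boolean elements of `S_n^D` of length `k`. -/
noncomputable def LD (n k : ℕ) : ℕ :=
  Nat.card {w : Equiv.Perm ℤ // IsTypeD n w ∧ BooleanD n w ∧ lenD n w = k}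



/-! ### Action of the generators -/

lemma sD_zero_apply (x : ℤ) : sD 0 x =
    if x = 1 then -2 else if x = 2 then -1 else if x = -1 then 2 else if x = -2 then 1 else x := by
  simp only [sD, sB, Equiv.Perm.mul_apply, Equiv.swap_apply_def]
  push_cast
  split_ifs <;> first | omega | contradiction

lemma sD_succ_apply (i : ℕ) (x : ℤ) : sD (i+1) x =
    if x = i + 1 then (i:ℤ) + 2 else if x = i + 2 then (i:ℤ) + 1
    else if x = -(i + 1) then -((i:ℤ) + 2) else if x = -(i + 2) then -((i:ℤ) + 1) else x := by
  simp only [sD, sB, Equiv.Perm.mul_apply, Equiv.swap_apply_def]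
  split_ifs <;> omega

/-- Relational description of `sD`. -/
lemma sD_spec (i : ℕ) (x : ℤ) :
    (i = 0 ∧ ((x = 1 ∧ sD i x = -2) ∨ (x = 2 ∧ sD i x = -1) ∨ (x = -1 ∧ sD i x = 2) ∨
      (x = -2 ∧ sD i x = 1) ∨ ((x < -2 ∨ x = 0 ∨ 2 < x) ∧ sD i x = x))) ∨
    (1 ≤ i ∧ ((x = i ∧ sD i x = i + 1) ∨ (x = i + 1 ∧ sD i x = i) ∨ (x = -i ∧ sD i x = -i - 1) ∨
      (x = -i - 1 ∧ sD i x = -i) ∨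
      ((x < -i - 1 ∨ (-i < x ∧ x < i) ∨ i + 1 < x) ∧ sD i x = x))) := by
  rcases i with _ | i
  · rw [sD_zero_apply]; split_ifs <;> omega
  · rw [sD_succ_apply]; split_ifs <;> omega

lemma sD_sD (i : ℕ) (x : ℤ) : sD i (sD i x) = x := by
  have h1 := sD_spec i x
  have h2 := sD_spec i (sD i x)
  generalize sD i (sD i x) = z at *
  generalize sD i x = y at *
  omega

lemma sD_mul_self (i : ℕ) : sD i * sD i = 1 := by
  ext x; simp [sD_sD]

lemma sD_neg (i : ℕ) (x : ℤ) : sD i (-x) = - sD i x := by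
  have h1 := sD_spec i x
  have h2 := sD_spec i (-x)
  generalize sD i (-x) = z at *
  generalize sD i x = y at *
  omega

/-- Noncommuting pairs of letters. -/
def AdjD (i j : ℕ) : Prop :=
  (i = 0 ∧ j = 2) ∨ (i = 2 ∧ j = 0) ∨ (1 ≤ i ∧ j = i + 1) ∨ (1 ≤ j ∧ i = j + 1)

lemma sD_comm {i j : ℕ} (h : ¬ AdjD i j) : Commute (sD i) (sD j) := by
  unfold AdjD at h
  ext x
  simp only [Equiv.Perm.mul_apply]
  by_cases hij : i = j
  · rw [hij]
  have h1 := sD_spec i x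
  have h2 := sD_spec j x
  have h3 := sD_spec i (sD j x)
  have h4 := sD_spec j (sD i x)
  generalize sD i (sD j x) = z at *
  generalize sD j (sD i x) = z' at *
  generalize sD i x = y at *
  generalize sD j x = y' at *
  rcases h1 with ⟨hi, h1⟩ | ⟨hi, h1⟩ <;> rcases h2 with ⟨hj, h2⟩ | ⟨hj, h2⟩
  · omega
  · have : j = 1 ∨ 3 ≤ j := by omega
    rcases h1 with h1 | h1 | h1 | h1 | h1 <;> omega
  · have : i = 1 ∨ 3 ≤ i := by omega
    rcases h2 with h1 | h1 | h1 | h1 | h1 <;> omega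
  · have : i + 2 ≤ j ∨ j + 2 ≤ i := by omega
    rcases h1 with h1 | h1 | h1 | h1 | h1 <;> omega

/-! ### Invariant sets of maximal parabolic subgroups -/

/-- A set of integers stabilized by every generator except the `i`-th. -/
def XD (i : ℕ) (x : ℤ) : Prop :=
  (i = 0 ∧ 1 ≤ x) ∨ (i = 1 ∧ (x = -1 ∨ 2 ≤ x)) ∨ (2 ≤ i ∧ (i : ℤ) < x)

/-- `g` preserves the predicate `A`. -/
def Pres (g : Equiv.Perm ℤ) (A : ℤ → Prop) : Prop := ∀ x, A (g x) ↔ A x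

lemma Pres.mul {g h : Equiv.Perm ℤ} {A : ℤ → Prop} (hg : Pres g A) (hh : Pres h A) :
    Pres (g * h) A := fun x => by
  rw [Equiv.Perm.mul_apply, hg, hh]

lemma Pres.inv {g : Equiv.Perm ℤ} {A : ℤ → Prop} (hg : Pres g A) : Pres g⁻¹ A := fun x => by
  rw [← hg (g⁻¹ x)]; simp

lemma Pres.right {g h : Equiv.Perm ℤ} {A : ℤ → Prop} (hg : Pres g A) (hh : Pres (g * h) A) :
    Pres h A := by
  have := hg.inv.mul hh
  simpa using this

lemma Pres.left {g h : Equiv.Perm ℤ} {A : ℤ → Prop} (hg : Pres h A) (hh : Pres (g * h) A) :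
    Pres g A := by
  have := hh.mul hg.inv
  simpa using this

lemma sD_pres {i j : ℕ} (h : i ≠ j) : Pres (sD i) (XD j) := by
  intro x
  have h1 := sD_spec i x
  unfold XD
  generalize sD i x = y at *
  omega

lemma sD_not_pres (i : ℕ) : ¬ Pres (sD i) (XD i) := by
  intro h
  have h0 := h ((i : ℤ) + 1)
  have h1 := sD_spec i ((i : ℤ) + 1)
  unfold XD at h0
  generalize sD i ((i : ℤ) + 1) = y at *
  omega

@[simp] lemma prodD_nil : prodD [] = 1 := rfl
@[simp] lemma prodD_cons (i : ℕ) (l : List ℕ) : prodD (i :: l) = sD i * prodD l := by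
  simp [prodD]
@[simp] lemma prodD_append (l l' : List ℕ) : prodD (l ++ l') = prodD l * prodD l' := by
  simp [prodD]

lemma prodD_pres {j : ℕ} {l : List ℕ} (h : j ∉ l) : Pres (prodD l) (XD j) := by
  induction l with
  | nil => intro x; simp
  | cons a l ih =>
    rw [prodD_cons]
    simp only [List.mem_cons, not_or] at h
    exact (sD_pres (Ne.symm h.1)).mul (ih h.2)

lemma not_pres_once {j : ℕ} {x y : List ℕ} (hx : j ∉ x) (hy : j ∉ y) :
    ¬ Pres (prodD (x ++ j :: y)) (XD j) := by
  intro h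
  rw [prodD_append, prodD_cons] at h
  exact sD_not_pres j (Pres.left (prodD_pres hy) ((prodD_pres hx).right h))

lemma nodup_split {j : ℕ} {l : List ℕ} (hl : l.Nodup) (hj : j ∈ l) :
    ∃ x y, l = x ++ j :: y ∧ j ∉ x ∧ j ∉ y ∧ (x ++ y).Nodup := by
  obtain ⟨x, y, rfl⟩ := List.append_of_mem hj
  have h2 := List.nodup_middle.1 hl
  rw [List.nodup_cons] at h2
  simp only [List.mem_append, not_or] at h2
  exact ⟨x, y, rfl, h2.1.1, h2.1.2, h2.2⟩

lemma mem_of_prod_eq {j : ℕ} {l l' : List ℕ} (hl : l.Nodup) (hj : j ∈ l)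
    (h : prodD l = prodD l') : j ∈ l' := by
  by_contra hn
  obtain ⟨x, y, rfl, hx, hy, -⟩ := nodup_split hl hj
  exact not_pres_once hx hy (h ▸ prodD_pres hn)

lemma prodD_two {x : List ℕ} (hx : x.Nodup) (h2 : 2 ∉ x) :
    prodD x 2 = if 0 ∈ x then (if 1 ∈ x then -2 else -1) else (if 1 ∈ x then 1 else 2) := by
  induction x with
  | nil => simp
  | cons a l ih =>
    rw [List.nodup_cons] at hx
    simp only [List.mem_cons, not_or] at h2
    rw [prodD_cons, Equiv.Perm.mul_apply, ih hx.2 h2.2]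
    have hs := sD_spec a
    have h1 := hx.1
    have e0 : (0 ∈ a :: l) ↔ (a = 0 ∨ 0 ∈ l) := by simp [eq_comm]
    have e1 : (1 ∈ a :: l) ↔ (a = 1 ∨ 1 ∈ l) := by simp [eq_comm]
    simp only [e0, e1]
    have c0 : a = 0 → 0 ∉ l := fun h => h ▸ h1
    have c1 : a = 1 → 1 ∉ l := fun h => h ▸ h1
    have s1 := hs 1
    have s2 := hs (-1)
    have s3 := hs 2
    have s4 := hs (-2)
    by_cases m0 : 0 ∈ l <;> by_cases m1 : 1 ∈ l <;>
      simp only [m0, m1, or_true, or_false, if_true, if_false, not_true, not_false_iff,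
        imp_false] at * <;> (try split_ifs) <;> omega

lemma comm_of_pres {s : ℕ} {x : List ℕ} (hs : s ∉ x) (hx : x.Nodup)
    (h : Pres (sD s * prodD x * sD s) (XD s)) : ∀ t ∈ x, Commute (sD s) (sD t) := by
  intro t ht
  apply sD_comm
  intro hadj
  have h1 : Pres (prodD x) (XD s) := prodD_pres hs
  have h2 : ∀ y, XD s (sD s (prodD x y)) ↔ XD s (sD s y) := by
    intro y
    have := h (sD s y)
    simpa [Equiv.Perm.mul_apply, sD_sD] using this
  have hnp : ¬ Pres (prodD x) (XD t) := by
    obtain ⟨y, z, rfl, hy, hz, -⟩ := nodup_split hx ht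
    exact not_pres_once hy hz
  have hinter : (∀ y, XD t y ↔ XD s y ∧ XD s (sD s y)) → False := by
    intro hh
    apply hnp
    intro y
    rw [hh, hh, h1, h2]
  have hunion : (∀ y, XD t y ↔ XD s y ∨ XD s (sD s y)) → False := by
    intro hh
    apply hnp
    intro y
    rw [hh, hh, h1, h2]
  have hcase2 : s = 2 → t ≤ 1 → False := by
    rintro rfl ht1
    have e1 := h1 2
    have e2 := h2 2
    have h3 := sD_spec 2 2
    have h4 := sD_spec 2 (prodD x 2)
    have h5 := prodD_two hx hs
    have : 0 ∈ x ∨ 1 ∈ x := by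
      interval_cases t
      · exact Or.inl ht
      · exact Or.inr ht
    unfold XD at e1 e2
    have h6 : prodD x 2 = -2 ∨ prodD x 2 = -1 ∨ prodD x 2 = 1 := by
      rw [h5]
      rcases this with h | h <;> simp only [h, if_true] <;> split_ifs <;> simp
    generalize sD 2 (prodD x 2) = z at *
    generalize sD 2 2 = z' at *
    generalize prodD x 2 = z'' at *
    omega
  rcases hadj with ⟨rfl, rfl⟩ | ⟨rfl, rfl⟩ | ⟨h3, rfl⟩ | ⟨h3, rfl⟩
  · apply hinter
    intro y
    have h6 := sD_spec 0 y
    unfold XD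
    generalize sD 0 y = z at *
    omega
  · exact hcase2 rfl (by omega)
  · apply hinter
    intro y
    have h6 := sD_spec s y
    unfold XD
    generalize sD s y = z at *
    omega
  · by_cases h4 : t = 1
    · exact hcase2 (by omega) (by omega)
    · apply hunion
      intro y
      have h6 := sD_spec (t+1) y
      unfold XD
      generalize sD (t+1) y = z at *
      omega

lemma prodD_comm {s : ℕ} {x : List ℕ} (h : ∀ t ∈ x, Commute (sD s) (sD t)) :
    sD s * prodD x = prodD x * sD s := by
  induction x with
  | nil => simp
  | cons a l ih =>
    rw [prodD_cons, ← mul_assoc, (h a (by simp)).eq, mul_assoc,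
      ih (fun t ht => h t (by simp [ht])), mul_assoc]



/-! ### Words with distinct letters -/

lemma nodup_len_le {l l' : List ℕ} (hl : l.Nodup) (h : prodD l = prodD l') :
    l.length ≤ l'.length :=
  (List.subperm_of_subset hl (fun _ hj => mem_of_prod_eq hl hj h)).length_le

lemma reduced_of_nodup {n : ℕ} {l : List ℕ} (hw : IsWordBD n l) (hl : l.Nodup) :
    ReducedD n l (prodD l) :=
  ⟨hw, rfl, fun _ _ h => nodup_len_le hl h.symm⟩

lemma perm_of_reduced {n : ℕ} {l b : List ℕ} (hw : IsWordBD n l) (hl : l.Nodup)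
    (hb : ReducedD n b (prodD l)) : l.Perm b :=
  (List.subperm_of_subset hl (fun _ hj => mem_of_prod_eq hl hj hb.2.1.symm)).perm_of_length_le
    (hb.2.2 l hw rfl)

lemma sublist_transfer {b b0 : List ℕ} (hb : b.Nodup) (hb0 : b0.Nodup)
    (h : prodD b = prodD b0) : ∀ a, a.Sublist b → ∃ a0, a0.Sublist b0 ∧ prodD a0 = prodD a := by
  induction b generalizing b0 with
  | nil =>
    intro a ha
    rw [List.sublist_nil] at ha
    exact ⟨[], by simp, by rw [ha]⟩
  | cons s b' ih =>
    intro a ha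
    obtain ⟨x, y, rfl, hx, hy, hxy⟩ := nodup_split hb0 (mem_of_prod_eq (j := s) hb (by simp) h)
    rw [List.nodup_cons] at hb
    have hb' : prodD b' = sD s * prodD x * sD s * prodD y := by
      have h1 : prodD b' = sD s * prodD (s :: b') := by
        rw [prodD_cons, ← mul_assoc, sD_mul_self, one_mul]
      rw [h1, h, prodD_append, prodD_cons]; group
    have hp : Pres (sD s * prodD x * sD s) (XD s) :=
      Pres.left (prodD_pres hy) (hb' ▸ prodD_pres hb.1)
    have hc := comm_of_pres hx (List.Nodup.of_append_left hxy) hp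
    have hb2 : prodD b' = prodD (x ++ y) := by
      rw [hb', prodD_comm hc, mul_assoc (prodD x), sD_mul_self, mul_one, prodD_append]
    rcases List.sublist_cons_iff.1 ha with ha | ⟨a', rfl, ha'⟩
    · obtain ⟨a0, h1, h2⟩ := ih hb.2 hxy hb2 a ha
      exact ⟨a0, h1.trans (List.Sublist.append_left (List.sublist_cons_self s y) x), h2⟩
    · obtain ⟨a0, h1, h2⟩ := ih hb.2 hxy hb2 a' ha'
      obtain ⟨x', y', rfl, hx', hy'⟩ := List.sublist_append_iff.1 h1
      refine ⟨x' ++ s :: y', hx'.append (hy'.cons_cons s), ?_⟩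
      rw [prodD_cons, ← h2, prodD_append, prodD_append, prodD_cons, ← mul_assoc, ← mul_assoc,
        prodD_comm (fun t ht => hc t (hx'.subset ht))]

lemma sublist_nodup_eq_filter {a b : List ℕ} (hb : b.Nodup) (h : a.Sublist b) :
    a = b.filter (fun i => decide (i ∈ a)) := by
  induction h with
  | slnil => simp
  | @cons l1 l2 c h ih =>
    rw [List.nodup_cons] at hb
    have : c ∉ l1 := fun hc => hb.1 (h.subset hc)
    rw [List.filter_cons_of_neg (by simpa using this)]
    exact ih hb.2
  | @cons_cons l1 l2 c h ih =>
    rw [List.nodup_cons] at hb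
    rw [List.filter_cons_of_pos (by simp)]
    congr 1
    conv_lhs => rw [ih hb.2]
    apply List.filter_congr
    intro x hx
    have : x ≠ c := fun h => hb.1 (h ▸ hx)
    simp [this]

open Classical in
/-- The subword of `b` with positions in `T`. -/
noncomputable def subW (b : List ℕ) (T : Finset (Fin b.length)) : List ℕ :=
  b.filter (fun i => decide (∃ k ∈ T, b.get k = i))

lemma subW_sublist (b : List ℕ) (T) : (subW b T).Sublist b := List.filter_sublist

lemma mem_subW {b : List ℕ} (hb : b.Nodup) (T) (k : Fin b.length) :
    b.get k ∈ subW b T ↔ k ∈ T := by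
  unfold subW
  rw [List.mem_filter]
  constructor
  · rintro ⟨-, h⟩
    obtain ⟨k', h1, h2⟩ := of_decide_eq_true h
    rwa [← List.nodup_iff_injective_get.1 hb h2]
  · intro h
    exact ⟨List.get_mem _ _, decide_eq_true ⟨k, h, rfl⟩⟩

lemma subW_mono (b : List ℕ) {T T' : Finset (Fin b.length)} (h : T ⊆ T') :
    (subW b T).Sublist (subW b T') := by
  apply List.monotone_filter_right
  intro a ha
  obtain ⟨k, h1, h2⟩ := of_decide_eq_true ha
  exact decide_eq_true ⟨k, h h1, h2⟩

lemma exists_subW {a b : List ℕ} (hb : b.Nodup) (h : a.Sublist b) : ∃ T, a = subW b T := by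
  classical
  refine ⟨Finset.univ.filter (fun k => b.get k ∈ a), ?_⟩
  conv_lhs => rw [sublist_nodup_eq_filter hb h]
  apply List.filter_congr
  intro x hx
  obtain ⟨k, rfl⟩ := List.get_of_mem hx
  rw [decide_eq_decide]
  constructor
  · intro h1
    exact ⟨k, by simpa using h1, rfl⟩
  · rintro ⟨k', h1, h2⟩
    rw [← h2]
    simpa using h1

lemma IsWordBD.sub {n : ℕ} {a b : List ℕ} (hb : IsWordBD n b) (h : a.Sublist b) : IsWordBD n a :=
  fun i hi => hb i (h.subset hi)

theorem boolean_of_nodup {n : ℕ} {b : List ℕ} (hw : IsWordBD n b) (hb : b.Nodup) :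
    BooleanD n (prodD b) := by
  have hred : ∀ T, ReducedD n (subW b T) (prodD (subW b T)) := fun T =>
    reduced_of_nodup (hw.sub (subW_sublist b T)) (hb.sublist (subW_sublist b T))
  let g : Finset (Fin b.length) → {v : Equiv.Perm ℤ // bruhatD n v (prodD b)} := fun T =>
    ⟨prodD (subW b T), subW b T, b, hred T, reduced_of_nodup hw hb, subW_sublist b T⟩
  have hle : ∀ T T', bruhatD n (g T).1 (g T').1 ↔ T ⊆ T' := by
    intro T T'
    constructor
    · rintro ⟨a, c, ha, hc, hac⟩ k hk
      rw [← mem_subW hb] at hk ⊢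
      have h1 : b.get k ∈ a :=
        mem_of_prod_eq (hb.sublist (subW_sublist b T)) hk ha.2.1.symm
      exact (perm_of_reduced (hw.sub (subW_sublist b T')) (hb.sublist (subW_sublist b T'))
        hc).mem_iff.2 (hac.subset h1)
    · intro h
      exact ⟨_, _, hred T, hred T', subW_mono b h⟩
  have hrefl : ∀ T, bruhatD n (g T).1 (g T).1 := fun T => (hle T T).2 (Finset.Subset.refl T)
  have hbij : Function.Bijective g := by
    constructor
    · intro T T' h
      apply Finset.Subset.antisymm
      · rw [← hle, ← h]; exact hrefl T
      · rw [← hle, ← h]; exact hrefl T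
    · rintro ⟨v, a, c, ha, hc, hac⟩
      have hp := perm_of_reduced hw hb hc
      obtain ⟨a0, h1, h2⟩ := sublist_transfer (hp.nodup_iff.1 hb) hb hc.2.1 a hac
      obtain ⟨T, rfl⟩ := exists_subW hb h1
      refine ⟨T, Subtype.ext ?_⟩
      change prodD (subW b T) = v
      rw [h2, ha.2.1]
  refine ⟨b.length, (Equiv.ofBijective g hbij).symm, fun x y => ?_⟩
  rw [← hle]
  have e1 : g ((Equiv.ofBijective g hbij).symm x) = x := (Equiv.ofBijective g hbij).apply_symm_apply x
  have e2 : g ((Equiv.ofBijective g hbij).symm y) = y := (Equiv.ofBijective g hbij).apply_symm_apply y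
  rw [e1, e2]



/-! ### Boolean elements have repetition-free reduced words -/

lemma reduced_len_eq {n : ℕ} {a b : List ℕ} {v : Equiv.Perm ℤ} (ha : ReducedD n a v)
    (hb : ReducedD n b v) : a.length = b.length :=
  le_antisymm (ha.2.2 b hb.1 hb.2.1) (hb.2.2 a ha.1 ha.2.1)

lemma isWord_append {n : ℕ} {p q : List ℕ} : IsWordBD n (p ++ q) ↔ IsWordBD n p ∧ IsWordBD n q := by
  unfold IsWordBD
  simp only [List.mem_append]
  constructor
  · intro h; exact ⟨fun i hi => h i (Or.inl hi), fun i hi => h i (Or.inr hi)⟩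
  · rintro ⟨h1, h2⟩ i (hi | hi)
    · exact h1 i hi
    · exact h2 i hi

lemma reduced_prefix {n : ℕ} {p q : List ℕ} {w : Equiv.Perm ℤ} (h : ReducedD n (p ++ q) w) :
    ReducedD n p (prodD p) := by
  obtain ⟨h1, h2, h3⟩ := h
  rw [isWord_append] at h1
  refine ⟨h1.1, rfl, fun w' hw' hp => ?_⟩
  have := h3 (w' ++ q) (isWord_append.2 ⟨hw', h1.2⟩) (by rw [prodD_append, hp, ← prodD_append, h2])
  simp only [List.length_append] at this
  omega

lemma reduced_replace {n : ℕ} {p p' q : List ℕ} {w : Equiv.Perm ℤ} (h : ReducedD n (p ++ q) w)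
    (h' : ReducedD n p' (prodD p)) : ReducedD n (p' ++ q) w := by
  have hl := reduced_len_eq h' (reduced_prefix h)
  obtain ⟨h1, h2, h3⟩ := h
  rw [isWord_append] at h1
  refine ⟨isWord_append.2 ⟨h'.1, h1.2⟩, by rw [prodD_append, h'.2.1, ← prodD_append, h2], ?_⟩
  intro w' hw' hp
  have := h3 w' hw' hp
  simp only [List.length_append] at this ⊢
  omega

lemma reduced_nil (n : ℕ) : ReducedD n [] 1 := ⟨by simp [IsWordBD], rfl, by simp⟩

lemma sD_ne_one (i : ℕ) : sD i ≠ 1 := by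
  intro h
  apply sD_not_pres i
  rw [h]
  intro x
  simp

lemma reduced_single {n t : ℕ} (h : t ≤ n - 1) : ReducedD n [t] (sD t) := by
  refine ⟨by simpa [IsWordBD] using h, by simp, fun w' _ h2 => ?_⟩
  cases w' with
  | nil => exact absurd h2.symm (sD_ne_one t)
  | cons a l => simp

lemma bruhat_len {n : ℕ} {a b : List ℕ} {v w : Equiv.Perm ℤ} (ha : ReducedD n a v)
    (hb : ReducedD n b w) (h : bruhatD n v w) :
    a.length ≤ b.length ∧ (a.length = b.length → v = w) := by
  obtain ⟨a', b', ha', hb', hs⟩ := h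
  rw [reduced_len_eq ha ha', reduced_len_eq hb hb']
  refine ⟨hs.length_le, fun he => ?_⟩
  have := hs.eq_of_length he
  rw [← ha'.2.1, ← hb'.2.1, this]

lemma bruhat_prefix {n : ℕ} {w : Equiv.Perm ℤ} {p q : List ℕ} (h : ReducedD n (p ++ q) w) : bruhatD n (prodD p) w :=
  ⟨p, p ++ q, reduced_prefix h, h, List.sublist_append_left p q⟩

lemma bruhat_letter {n : ℕ} {b : List ℕ} {v : Equiv.Perm ℤ} {t : ℕ} (h : ReducedD n b v) (ht : t ∈ b) :
    bruhatD n (sD t) v :=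
  ⟨[t], b, reduced_single (h.1 t ht), h, List.singleton_sublist.2 ht⟩

lemma e_one {n : ℕ} {w : Equiv.Perm ℤ} {r : ℕ}
    (e : {v : Equiv.Perm ℤ // bruhatD n v w} ≃ Finset (Fin r))
    (he : ∀ a b : {v : Equiv.Perm ℤ // bruhatD n v w}, bruhatD n a.1 b.1 ↔ e a ⊆ e b)
    (h1 : bruhatD n 1 w) : e ⟨1, h1⟩ = ∅ := by
  apply Finset.subset_empty.1
  have : e (e.symm ∅) = ∅ := e.apply_symm_apply ∅
  rw [← this, ← he]
  obtain ⟨a, b, ha, hb, hs⟩ := (e.symm ∅).2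
  exact ⟨[], a, reduced_nil n, ha, List.nil_sublist a⟩

lemma e_rank {n : ℕ} {w : Equiv.Perm ℤ} {r : ℕ}
    (e : {v : Equiv.Perm ℤ // bruhatD n v w} ≃ Finset (Fin r))
    (he : ∀ a b : {v : Equiv.Perm ℤ // bruhatD n v w}, bruhatD n a.1 b.1 ↔ e a ⊆ e b)
    (p q : List ℕ) (h : ReducedD n (p ++ q) w) :
    (e ⟨prodD p, bruhat_prefix h⟩).card = p.length := by
  induction p using List.reverseRecOn generalizing q with
  | nil =>
    have : e ⟨prodD [], bruhat_prefix h⟩ = ∅ := e_one e he _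
    rw [this]; rfl
  | append_singleton p t ih =>
    have h' : ReducedD n (p ++ (t :: q)) w := by simpa using h
    have ih' := ih (t :: q) h'
    set A := e ⟨prodD p, bruhat_prefix h'⟩ with hA
    set B := e ⟨prodD (p ++ [t]), bruhat_prefix h⟩ with hB
    have r1 := reduced_prefix h'
    have r2 := reduced_prefix h
    have hAB : A ⊆ B := by
      rw [hA, hB, ← he]
      exact ⟨p, p ++ [t], r1, r2, List.sublist_append_left p [t]⟩
    have hne : A ≠ B := by
      intro hh
      have h3 := congrArg Subtype.val (e.injective hh)
      have h4 : prodD p = prodD (p ++ [t]) := h3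
      have h5 := r2.2.2 p r1.1 h4
      simp at h5
    obtain ⟨x, hx, hxA⟩ := Finset.exists_of_ssubset (Finset.ssubset_iff_subset_ne.2 ⟨hAB, hne⟩)
    have hT : insert x A = B := by
      set v := e.symm (insert x A) with hv
      have ev : e v = insert x A := e.apply_symm_apply _
      have b1 : bruhatD n (prodD p) v.1 := by
        have := (he ⟨prodD p, bruhat_prefix h'⟩ v).2 (by rw [ev]; exact Finset.subset_insert x A)
        exact this
      have b2 : bruhatD n v.1 (prodD (p ++ [t])) := by
        have := (he v ⟨prodD (p ++ [t]), bruhat_prefix h⟩).2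
          (by rw [ev]; exact Finset.insert_subset hx hAB)
        exact this
      have b2' := b2
      obtain ⟨a, _, ha, -, -⟩ := b2'
      have l1 := bruhat_len r1 ha b1
      have l2 := bruhat_len ha r2 b2
      simp only [List.length_append, List.length_singleton] at l2
      have : a.length = p.length ∨ a.length = p.length + 1 := by omega
      rcases this with h0 | h0
      · have h3 := l1.2 h0.symm
        have h4 : v = ⟨prodD p, bruhat_prefix h'⟩ := Subtype.ext h3.symm
        rw [h4] at ev
        have h5 : A = insert x A := ev
        exact absurd (h5.symm ▸ Finset.mem_insert_self x A : x ∈ A) hxA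
      · have h3 := l2.2 h0
        have h4 : v = ⟨prodD (p ++ [t]), bruhat_prefix h⟩ := Subtype.ext h3
        rw [h4] at ev
        exact ev.symm
    rw [← hT, Finset.card_insert_of_notMem hxA, ih']
    simp

lemma e_atom {n : ℕ} {w : Equiv.Perm ℤ} {r : ℕ}
    (e : {v : Equiv.Perm ℤ // bruhatD n v w} ≃ Finset (Fin r))
    (he : ∀ a b : {v : Equiv.Perm ℤ // bruhatD n v w}, bruhatD n a.1 b.1 ↔ e a ⊆ e b)
    (p q : List ℕ) (h : ReducedD n (p ++ q) w) (x : Fin r)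
    (hx : x ∈ e ⟨prodD p, bruhat_prefix h⟩) :
    ∃ t b', ReducedD n b' (prodD p) ∧ t ∈ b' ∧ ∃ ht : bruhatD n (sD t) w, e ⟨sD t, ht⟩ = {x} := by
  set v := e.symm {x} with hv
  have ev : e v = {x} := e.apply_symm_apply _
  have hvp : bruhatD n v.1 (prodD p) := by
    have := (he v ⟨prodD p, bruhat_prefix h⟩).2 (by rw [ev]; simpa using hx)
    exact this
  obtain ⟨a, b', ha, hb', hs⟩ := hvp
  have h1 : bruhatD n 1 w := ⟨[], _, reduced_nil n, h, List.nil_sublist _⟩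
  cases a with
  | nil =>
    have h2 : v = ⟨1, h1⟩ := Subtype.ext ha.2.1.symm
    rw [h2, e_one e he] at ev
    exact absurd ev.symm (Finset.singleton_ne_empty x)
  | cons t a' =>
    have htb : t ∈ b' := hs.subset (by simp)
    have htw : bruhatD n (sD t) w := bruhat_letter (reduced_replace h hb') (by simp [htb])
    refine ⟨t, b', hb', htb, htw, ?_⟩
    have h3 : e ⟨sD t, htw⟩ ⊆ {x} := by
      rw [← ev, ← he]
      exact bruhat_letter ha (by simp)
    rcases Finset.subset_singleton_iff.1 h3 with h4 | h4
    · rw [← e_one e he h1] at h4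
      exact absurd (congrArg Subtype.val (e.injective h4)) (sD_ne_one t)
    · exact h4

lemma prefix_nodup {n : ℕ} {w : Equiv.Perm ℤ} {r : ℕ}
    (e : {v : Equiv.Perm ℤ // bruhatD n v w} ≃ Finset (Fin r))
    (he : ∀ a b : {v : Equiv.Perm ℤ // bruhatD n v w}, bruhatD n a.1 b.1 ↔ e a ⊆ e b)
    (k : ℕ) : ∀ p q : List ℕ, ReducedD n (p ++ q) w → p.length = k → p.Nodup := by
  induction k with
  | zero =>
    intro p q _ hp
    rw [List.length_eq_zero_iff.1 hp]
    exact List.nodup_nil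
  | succ k ih =>
    intro p' q h hp
    obtain ⟨p, t, rfl⟩ : ∃ p t, p' = p ++ [t] := by
      rcases List.eq_nil_or_concat p' with h0 | ⟨p, t, h0⟩
      · rw [h0] at hp; simp at hp
      · exact ⟨p, t, by simpa using h0⟩
    have hpk : p.length = k := by simpa using hp
    have h' : ReducedD n (p ++ (t :: q)) w := by simpa using h
    have hpn := ih p (t :: q) h' hpk
    by_contra hcon
    have htp : t ∈ p := by
      by_contra htp
      apply hcon
      rw [List.nodup_append]
      refine ⟨hpn, by simp, ?_⟩
      intro a ha b hb
      simp only [List.mem_singleton] at hb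
      rintro rfl
      exact htp (hb ▸ ha)
    have hatom := e_atom e he (p ++ [t]) q h
    choose! τ b' hb1 hb2 hb3 hb4 using hatom
    have hcard := e_rank e he (p ++ [t]) q h
    set B := e ⟨prodD (p ++ [t]), bruhat_prefix h⟩ with hB
    have hinj : Set.InjOn τ B := by
      intro x hx y hy hxy
      have h1 := hb4 x hx
      have h2 := hb4 y hy
      have h3 : e ⟨sD (τ x), hb3 x hx⟩ = e ⟨sD (τ y), hb3 y hy⟩ := by
        congr 2; rw [hxy]
      rw [h1, h2] at h3
      exact Finset.singleton_injective h3
    have hlt : p.toFinset.card < (B.image τ).card := by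
      rw [Finset.card_image_of_injOn hinj, hcard]
      have := p.toFinset_card_le
      simp only [List.length_append, List.length_singleton]
      omega
    obtain ⟨u, hu1, hu2⟩ := Finset.exists_mem_notMem_of_card_lt_card hlt
    obtain ⟨x, hxB, rfl⟩ := Finset.mem_image.1 hu1
    rw [List.mem_toFinset] at hu2
    have hred := hb1 x hxB
    have hmem := hb2 x hxB
    generalize τ x = u at *
    generalize b' x = d at *
    have hun : u ∉ p ++ [t] := by
      simp only [List.mem_append, List.mem_singleton, not_or]
      exact ⟨hu2, fun hh => hu2 (hh ▸ htp)⟩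
    have hpres : Pres (prodD d) (XD u) := hred.2.1 ▸ prodD_pres hun
    have hdl : d.length = k + 1 := by
      rw [reduced_len_eq hred (reduced_prefix h)]; exact hp
    obtain ⟨c, s, rfl⟩ : ∃ c s, d = c ++ [s] := by
      rcases List.eq_nil_or_concat d with h0 | ⟨p, t, h0⟩
      · rw [h0] at hdl; simp at hdl
      · exact ⟨p, t, by simpa using h0⟩
    have hcn : c.Nodup := by
      have := reduced_replace h hred
      exact ih c (s :: q) (by simpa using this) (by simpa using hdl)
    by_cases huc : u ∈ c
    · obtain ⟨y, z, rfl, hy, hz, hyz⟩ := nodup_split hcn huc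
      by_cases hus : u = s
      · subst hus
        have e1 : prodD ((y ++ u :: z) ++ [u]) = prodD y * (sD u * prodD z * sD u) := by
          simp [mul_assoc]
        rw [e1] at hpres
        have hc := comm_of_pres hz (List.Nodup.of_append_right hyz) ((prodD_pres hy).right hpres)
        have e2 : prodD ((y ++ u :: z) ++ [u]) = prodD (y ++ z) := by
          rw [e1, prodD_comm hc, mul_assoc (prodD z), sD_mul_self, mul_one, prodD_append]
        have hsub : (y ++ z).Sublist ((y ++ u :: z) ++ [u]) :=
          (List.Sublist.append_left (List.sublist_cons_self u z) y).trans
            (List.sublist_append_left _ _)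
        have := hred.2.2 (y ++ z) (hred.1.sub hsub) (by rw [← e2, hred.2.1])
        simp at this
      · have : (y ++ u :: z) ++ [s] = y ++ u :: (z ++ [s]) := by simp
        rw [this] at hpres
        exact not_pres_once hy (by simp [hz, hus]) hpres
    · have : u = s := by simpa [huc] using hmem
      subst this
      exact not_pres_once huc (by simp) hpres

theorem nodup_of_boolean {n : ℕ} {w : Equiv.Perm ℤ} (h : BooleanD n w) :
    ∃ b, IsWordBD n b ∧ b.Nodup ∧ prodD b = w := by
  obtain ⟨r, e, he⟩ := h
  obtain ⟨a, b, ha, hb, hs⟩ := (e.symm ∅).2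
  refine ⟨b, hb.1, ?_, hb.2.1⟩
  exact prefix_nodup e he b.length b [] (by simpa using hb) rfl



/-! ### Patterns: words with distinct letters avoid them -/

/-- The twenty patterns. -/
def pats : List (List ℤ) :=
  [[-1,-2,-3], [-1,-3,-2], [-2,-1,-3], [-2,-3,-1], [-3,-1,-2], [-3,-2,-1],
   [3,2,1], [3,4,1,2], [3,2,-1], [3,-1,-2], [3,4,-1,2], [3,4,-2,-1],
   [-3,2,1], [-2,-3,1], [-3,4,1,2], [-4,-3,1,2], [1,-2], [3,-2,1],
   [-3,2,-1], [-3,4,-1,2]]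

/-- If the largest entry is positive, at least two entries follow it. -/
def Good2 (p : List ℤ) : Prop := ∀ j : Fin p.length, 0 < p.get j →
  (∀ j', j' ≠ j → |p.get j'| < |p.get j|) → ∃ j1 j2, j < j1 ∧ j1 < j2

/-- If the last entry is positive, at least two entries exceed it. -/
def Good3 (p : List ℤ) : Prop := ∀ j : Fin p.length, (∀ j', j' ≤ j) → 0 < p.get j →
  ∃ j1 j2, |p.get j| < |p.get j1| ∧ |p.get j1| < |p.get j2|

instance (p : List ℤ) : Decidable (Good2 p) := by unfold Good2; infer_instance
instance (p : List ℤ) : Decidable (Good3 p) := by unfold Good3; infer_instance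

set_option maxRecDepth 100000 in
lemma pats_good : ∀ p ∈ pats, Good2 p ∧ Good3 p := by decide

lemma contains_mono {m n : ℕ} (h : m ≤ n) {w : Equiv.Perm ℤ} {p : List ℤ}
    (hc : containsPat m w p) : containsPat n w p := by
  obtain ⟨f, h1, h2, h3, h4⟩ := hc
  exact ⟨f, h1, fun j => ⟨(h2 j).1, (h2 j).2.trans (by exact_mod_cast h)⟩, h3, h4⟩

lemma signed_abs_le {m : ℕ} {u : Equiv.Perm ℤ} (hu : IsSignedPerm m u) {x : ℤ}
    (hx : |x| ≤ m) : |u x| ≤ m := by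
  by_contra h
  push Not at h
  have h1 := hu.2 (u x) h
  have h2 := u.injective h1
  rw [h2] at h
  omega

lemma signed_ne_zero {m : ℕ} {u : Equiv.Perm ℤ} (hu : IsSignedPerm m u) {x : ℤ}
    (hx : x ≠ 0) : u x ≠ 0 := by
  intro h
  have h0 : u 0 = 0 := by
    have := hu.1 0
    simp at this
    omega
  exact hx (u.injective (h.trans h0.symm))

lemma signed_succ {m : ℕ} {u : Equiv.Perm ℤ} (hu : IsSignedPerm m u) : u (m + 1) = m + 1 :=
  hu.2 _ (by rw [abs_of_nonneg (by omega)]; omega)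

lemma contains_down1 {m : ℕ} {u : Equiv.Perm ℤ} (hu : IsSignedPerm m u) {p : List ℤ}
    (hp : Good2 p) (hc : containsPat (m+1) u p) : containsPat m u p := by
  obtain ⟨f, h1, h2, h3, h4⟩ := hc
  refine ⟨f, h1, fun j => ⟨(h2 j).1, ?_⟩, h3, h4⟩
  by_contra hj
  have hfj : f j = m + 1 := by have := (h2 j).2; push_cast at this; omega
  have huj : u (f j) = m + 1 := by rw [hfj, signed_succ hu]
  obtain ⟨j1, j2, hj1, hj2⟩ := hp j ((h3 j).1 (by rw [huj]; omega)) (by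
    intro j' hj'
    rw [← h4, huj, abs_of_nonneg (a := (m:ℤ)+1) (by omega)]
    have hlt : f j' < m + 1 := by
      have h5 := (h2 j').2
      have h6 : f j' ≠ f j := fun h => hj' (h1.injective h)
      push_cast at h5
      omega
    have := signed_abs_le hu (x := f j') (by rw [abs_of_nonneg (by have := (h2 j').1; omega)]; omega)
    omega)
  have := h1 hj1
  have := (h2 j1).2
  push_cast at this
  omega

lemma contains_down2 {m : ℕ} (hm : 1 ≤ m) {u : Equiv.Perm ℤ} (hu : IsSignedPerm m u) {p : List ℤ}
    (hp : Good2 p) (hc : containsPat (m+1) (u * sD m) p) : containsPat m u p := by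
  obtain ⟨f, h1, h2, h3, h4⟩ := hc
  simp only [Equiv.Perm.mul_apply] at h3 h4
  have key : ∀ j, f j ≠ m := by
    intro j hfj
    have hs : sD m (f j) = m + 1 := by
      have := sD_spec m (f j); omega
    have huj : u (sD m (f j)) = m + 1 := by rw [hs, signed_succ hu]
    obtain ⟨j1, j2, hj1, hj2⟩ := hp j ((h3 j).1 (by rw [huj]; omega)) (by
      intro j' hj'
      rw [← h4, huj, abs_of_nonneg (a := (m:ℤ)+1) (by omega)]
      have h5 := h2 j'
      have h6 : f j' ≠ f j := fun h => hj' (h1.injective h)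
      have h7 := sD_spec m (f j')
      push_cast at h5
      have := signed_abs_le hu (x := sD m (f j')) (by
        rw [abs_of_nonneg (by omega)]; omega)
      omega)
    have := h1 hj1
    have := h1 hj2
    have := (h2 j2).2
    push_cast at this
    omega
  refine ⟨fun j => sD m (f j), ?_, ?_, h3, h4⟩
  · intro a b hab
    have e1 := h1 hab
    have e2 := h2 a
    have e3 := h2 b
    have e4 := key a
    have e5 := key b
    have e6 := sD_spec m (f a)
    have e7 := sD_spec m (f b)
    push_cast at e2 e3
    change sD m (f a) < sD m (f b)
    omega
  · intro j
    have e2 := h2 j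
    have e4 := key j
    have e6 := sD_spec m (f j)
    push_cast at e2
    change 1 ≤ sD m (f j) ∧ sD m (f j) ≤ m
    omega

/-- `sD m` is order preserving in absolute value on `[-m, m]`, and sign preserving. -/
lemma sD_abs {m : ℕ} (hm : 1 ≤ m) {x y : ℤ} (hx : |x| ≤ m) (hy : |y| ≤ m) :
    |sD m x| < |sD m y| ↔ |x| < |y| := by
  have h1 := sD_spec m x
  have h2 := sD_spec m y
  simp only [abs_eq_max_neg] at *
  omega

lemma sD_sign {m : ℕ} (hm : 1 ≤ m) (x : ℤ) : 0 < sD m x ↔ 0 < x := by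
  have h1 := sD_spec m x
  omega

lemma contains_down3 {m : ℕ} (hm : 1 ≤ m) {u : Equiv.Perm ℤ} (hu : IsSignedPerm m u) {p : List ℤ}
    (hp : Good3 p) (hc : containsPat (m+1) (sD m * u) p) : containsPat m u p := by
  obtain ⟨f, h1, h2, h3, h4⟩ := hc
  simp only [Equiv.Perm.mul_apply] at h3 h4
  have key : ∀ j, f j ≤ m := by
    intro j
    by_contra hj
    have hfj : f j = m + 1 := by have := (h2 j).2; push_cast at this; omega
    have hs : sD m (u (f j)) = m := by
      rw [hfj, signed_succ hu]
      have := sD_spec m (m+1); omega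
    obtain ⟨j1, j2, hj1, hj2⟩ := hp j (by
      intro j'
      by_contra hlt
      push Not at hlt
      have := h1 hlt
      have := (h2 j').2
      push_cast at this
      omega) ((h3 j).1 (by rw [hs]; omega))
    rw [← h4] at hj1 hj2
    have e1 : |u (f j2)| ≤ m + 1 := by
      have : IsSignedPerm (m+1) u := ⟨hu.1, fun x hx => hu.2 x (by push_cast at hx; omega)⟩
      have h5 := h2 j2
      have := signed_abs_le this (x := f j2) (by rw [abs_of_nonneg (by omega)]; exact h5.2)
      push_cast at this
      exact this
    have e2 := sD_spec m (u (f j2))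
    rw [hs] at hj1
    simp only [abs_eq_max_neg] at *
    omega
  have hle : ∀ j, |u (f j)| ≤ m := fun j =>
    signed_abs_le hu (by rw [abs_of_nonneg (by have := (h2 j).1; omega)]; exact key j)
  refine ⟨f, h1, fun j => ⟨(h2 j).1, key j⟩, fun j => ?_, fun j j' => ?_⟩
  · rw [← h3, sD_sign hm]
  · rw [← h4, sD_abs hm (hle j) (hle j')]

lemma contains_up2 {m : ℕ} (hm : 1 ≤ m) {u : Equiv.Perm ℤ} {p : List ℤ}
    (hc : containsPat m u p) : containsPat (m+1) (u * sD m) p := by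
  obtain ⟨f, h1, h2, h3, h4⟩ := hc
  refine ⟨fun j => sD m (f j), ?_, ?_, ?_, ?_⟩
  · intro a b hab
    have e1 := h1 hab
    have e2 := h2 a
    have e3 := h2 b
    have e6 := sD_spec m (f a)
    have e7 := sD_spec m (f b)
    change sD m (f a) < sD m (f b)
    omega
  · intro j
    have e2 := h2 j
    have e6 := sD_spec m (f j)
    push_cast
    omega
  · intro j
    rw [← h3, Equiv.Perm.mul_apply, sD_sD]
  · intro j j'
    rw [← h4, Equiv.Perm.mul_apply, sD_sD, Equiv.Perm.mul_apply, sD_sD]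

lemma contains_up3 {m : ℕ} (hm : 1 ≤ m) {u : Equiv.Perm ℤ} (hu : IsSignedPerm m u) {p : List ℤ}
    (hc : containsPat m u p) : containsPat (m+1) (sD m * u) p := by
  obtain ⟨f, h1, h2, h3, h4⟩ := hc
  have hle : ∀ j, |u (f j)| ≤ m := fun j =>
    signed_abs_le hu (by rw [abs_of_nonneg (by have := (h2 j).1; omega)]; exact (h2 j).2)
  refine ⟨f, h1, fun j => ⟨(h2 j).1, ?_⟩, fun j => ?_, fun j j' => ?_⟩
  · have := (h2 j).2; push_cast; omega
  · rw [← h3, Equiv.Perm.mul_apply, sD_sign hm]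
  · rw [← h4, Equiv.Perm.mul_apply, Equiv.Perm.mul_apply, sD_abs hm (hle j) (hle j')]

lemma prodD_signed {m : ℕ} (hm : 2 ≤ m) {l : List ℕ} (hl : IsWordBD m l) :
    IsSignedPerm m (prodD l) := by
  induction l with
  | nil => exact ⟨by simp, by simp⟩
  | cons a l ih =>
    have ih' := ih (hl.sub (List.sublist_cons_self a l))
    have ha := hl a (by simp)
    refine ⟨fun x => ?_, fun x hx => ?_⟩
    · rw [prodD_cons, Equiv.Perm.mul_apply, ih'.1, sD_neg, Equiv.Perm.mul_apply]
    · rw [prodD_cons, Equiv.Perm.mul_apply, ih'.2 x hx]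
      have := sD_spec a x
      simp only [abs_eq_max_neg] at hx
      omega

lemma word_structure {m : ℕ} (hm : 3 ≤ m) {b : List ℕ} (hb : IsWordBD (m+1) b) (hn : b.Nodup) :
    ∃ c, IsWordBD m c ∧ c.Nodup ∧
      (prodD b = prodD c ∨ prodD b = prodD c * sD m ∨ prodD b = sD m * prodD c) := by
  have hsub : ∀ c : List ℕ, m ∉ c → (∀ i ∈ c, i ∈ b) → IsWordBD m c := by
    intro c hc h i hi
    have h1 := hb i (h i hi)
    have h2 : i ≠ m := fun h => hc (h ▸ hi)
    omega
  have hcomm : ∀ c : List ℕ, m ∉ c → m - 1 ∉ c → (∀ i ∈ c, i ∈ b) →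
      sD m * prodD c = prodD c * sD m := by
    intro c hc hc' h
    apply prodD_comm
    intro t ht
    apply sD_comm
    have h1 := hb t (h t ht)
    have h2 : t ≠ m := fun h => hc (h ▸ ht)
    have h3 : t ≠ m - 1 := fun h => hc' (h ▸ ht)
    unfold AdjD
    omega
  by_cases hmb : m ∈ b
  · obtain ⟨x, y, rfl, hx, hy, hxy⟩ := nodup_split hn hmb
    refine ⟨x ++ y, hsub _ (by simp [hx, hy]) (by simp; tauto), hxy, ?_⟩
    right
    by_cases h1 : m - 1 ∈ x
    · have h2 : m - 1 ∉ y := fun h => List.disjoint_of_nodup_append hxy h1 h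
      left
      have := hcomm y hy h2 (by simp; tauto)
      rw [prodD_append, prodD_cons, this, prodD_append, mul_assoc]
    · right
      have := hcomm x hx h1 (by simp; tauto)
      rw [prodD_append, prodD_cons, ← mul_assoc, ← this, prodD_append, mul_assoc]
  · exact ⟨b, hsub b hmb (fun _ h => h), hn, Or.inl rfl⟩



/-! ### The base case `n = 3` -/

/-- Match of a length-3 pattern. -/
def T3 (a b c p q r : ℤ) : Prop :=
  (0 < a ↔ 0 < p) ∧ (0 < b ↔ 0 < q) ∧ (0 < c ↔ 0 < r) ∧
  (|a| < |b| ↔ |p| < |q|) ∧ (|a| < |c| ↔ |p| < |r|) ∧ (|b| < |c| ↔ |q| < |r|)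

/-- Match of the pattern `1 (-2)`. -/
def T2 (a b : ℤ) : Prop := 0 < a ∧ b ≤ 0 ∧ |a| < |b|

/-- Absence of matches for a triple of values. -/
def Chk (a b c : ℤ) : Prop :=
  ¬ T2 a b ∧ ¬ T2 a c ∧ ¬ T2 b c ∧
  ¬ T3 a b c (-1) (-2) (-3) ∧ ¬ T3 a b c (-1) (-3) (-2) ∧ ¬ T3 a b c (-2) (-1) (-3) ∧
  ¬ T3 a b c (-2) (-3) (-1) ∧ ¬ T3 a b c (-3) (-1) (-2) ∧ ¬ T3 a b c (-3) (-2) (-1) ∧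
  ¬ T3 a b c 3 2 1 ∧ ¬ T3 a b c 3 2 (-1) ∧ ¬ T3 a b c 3 (-1) (-2) ∧
  ¬ T3 a b c (-3) 2 1 ∧ ¬ T3 a b c (-2) (-3) 1 ∧ ¬ T3 a b c 3 (-2) 1 ∧ ¬ T3 a b c (-3) 2 (-1)

instance (a b c p q r : ℤ) : Decidable (T3 a b c p q r) := by unfold T3; infer_instance
instance (a b : ℤ) : Decidable (T2 a b) := by unfold T2; infer_instance
instance (a b c : ℤ) : Decidable (Chk a b c) := by unfold Chk; infer_instance

lemma contains_T3 {w : Equiv.Perm ℤ} {p q r : ℤ} (h : containsPat 3 w [p, q, r]) :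
    T3 (w 1) (w 2) (w 3) p q r := by
  obtain ⟨f, h1, h2, h3, h4⟩ := h
  have a0 := h2 (0 : Fin 3)
  have a1 := h2 (1 : Fin 3)
  have a2 := h2 (2 : Fin 3)
  have b0 := h1 (show (0 : Fin 3) < 1 by decide)
  have b1 := h1 (show (1 : Fin 3) < 2 by decide)
  push_cast at a0 a1 a2
  have c0 : f (0 : Fin 3) = 1 := by omega
  have c1 : f (1 : Fin 3) = 2 := by omega
  have c2 : f (2 : Fin 3) = 3 := by omega
  rw [← c0, ← c1, ← c2]
  exact ⟨h3 (0 : Fin 3), h3 (1 : Fin 3), h3 (2 : Fin 3), h4 (0 : Fin 3) (1 : Fin 3),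
    h4 (0 : Fin 3) (2 : Fin 3), h4 (1 : Fin 3) (2 : Fin 3)⟩

lemma contains_T2 {n : ℕ} {w : Equiv.Perm ℤ} (h : containsPat n w [1, -2]) :
    ∃ a b : ℤ, 1 ≤ a ∧ a < b ∧ b ≤ n ∧ T2 (w a) (w b) := by
  obtain ⟨f, h1, h2, h3, h4⟩ := h
  have a0 := h2 (0 : Fin 2)
  have a1 := h2 (1 : Fin 2)
  have b0 := h1 (show (0 : Fin 2) < 1 by decide)
  refine ⟨f (0 : Fin 2), f (1 : Fin 2), a0.1, b0, a1.2, ?_, ?_, ?_⟩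
  · exact (h3 (0 : Fin 2)).2 (by decide)
  · have := (h3 (1 : Fin 2)).not.2 (by decide)
    omega
  · exact (h4 (0 : Fin 2) (1 : Fin 2)).2 (by decide)

lemma not_contains_four {w : Equiv.Perm ℤ} {p q r s : ℤ} (h : containsPat 3 w [p, q, r, s]) :
    False := by
  obtain ⟨f, h1, h2, h3, h4⟩ := h
  have a0 := h2 (0 : Fin 4)
  have a1 := h2 (3 : Fin 4)
  have b0 := h1 (show (0 : Fin 4) < 1 by decide)
  have b1 := h1 (show (1 : Fin 4) < 2 by decide)
  have b2 := h1 (show (2 : Fin 4) < 3 by decide)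
  push_cast at a0 a1
  omega

lemma avoid_of_Chk {w : Equiv.Perm ℤ} (h : Chk (w 1) (w 2) (w 3)) :
    ∀ p ∈ pats, avoidsPat 3 w p := by
  obtain ⟨t1, t2, t3, c1, c2, c3, c4, c5, c6, c7, c8, c9, c10, c11, c12, c13⟩ := h
  have h2 : avoidsPat 3 w [1, -2] := by
    intro h
    obtain ⟨a, b, h1, h2, h3, h4⟩ := contains_T2 h
    push_cast at h3
    have : (a = 1 ∧ b = 2) ∨ (a = 1 ∧ b = 3) ∨ (a = 2 ∧ b = 3) := by omega
    rcases this with ⟨rfl, rfl⟩ | ⟨rfl, rfl⟩ | ⟨rfl, rfl⟩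
    · exact t1 h4
    · exact t2 h4
    · exact t3 h4
  simp only [pats, List.forall_mem_cons]
  refine ⟨?_, ?_, ?_, ?_, ?_, ?_, ?_, ?_, ?_, ?_, ?_, ?_, ?_, ?_, ?_, ?_, h2, ?_, ?_, ?_, ?_⟩
  all_goals first
    | exact fun h => not_contains_four h
    | exact fun h => by
        have := contains_T3 h
        contradiction
    | simp

lemma chk3' : ∀ a b c : Fin 3, ¬ (a ≠ b ∧ a ≠ c ∧ b ≠ c) ∨
    Chk (prodD [a.1, b.1, c.1] 1) (prodD [a.1, b.1, c.1] 2) (prodD [a.1, b.1, c.1] 3) := by decide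
lemma chk3 (a : ℕ) (ha : a < 3) (b : ℕ) (hb : b < 3) (c : ℕ) (hc : c < 3) (h1 : a ≠ b)
    (h2 : a ≠ c) (h3 : b ≠ c) :
    Chk (prodD [a, b, c] 1) (prodD [a, b, c] 2) (prodD [a, b, c] 3) :=
  (chk3' ⟨a, ha⟩ ⟨b, hb⟩ ⟨c, hc⟩).resolve_left (not_not.2 (by simp [h1, h2, h3]))
lemma chk2 : ∀ a < 3, ∀ b < 3, a ≠ b →
    Chk (prodD [a, b] 1) (prodD [a, b] 2) (prodD [a, b] 3) := by decide
lemma chk1 : ∀ a < 3, Chk (prodD [a] 1) (prodD [a] 2) (prodD [a] 3) := by decide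
lemma chk0 : Chk (prodD [] 1) (prodD [] 2) (prodD [] 3) := by decide

lemma avoid_three {b : List ℕ} (hb : IsWordBD 3 b) (hn : b.Nodup) :
    ∀ p ∈ pats, avoidsPat 3 (prodD b) p := by
  apply avoid_of_Chk
  have hb' : ∀ i ∈ b, i < 3 := fun i hi => by have := hb i hi; omega
  match b, hb', hn with
  | [], _, _ => exact chk0
  | [a], h, _ => exact chk1 a (h a (by simp))
  | [a, b], h, h' => exact chk2 a (h a (by simp)) b (h b (by simp)) (by simpa using h')
  | [a, b, c], h, h' =>
    simp only [List.nodup_cons, List.mem_cons, not_or, List.not_mem_nil] at h'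
    exact chk3 a (h a (by simp)) b (h b (by simp)) c (h c (by simp)) h'.1.1 h'.1.2.1 h'.2.1.1
  | a :: b :: c :: d :: l, h, h' =>
    simp only [List.nodup_cons, List.mem_cons, not_or] at h'
    have := h a (by simp)
    have := h b (by simp)
    have := h c (by simp)
    have := h d (by simp)
    omega

theorem avoid_of_nodup (n : ℕ) : ∀ b : List ℕ, IsWordBD n b → b.Nodup →
    ∀ p ∈ pats, avoidsPat n (prodD b) p := by
  induction n with
  | zero =>
    intro b hb hn p hp hc
    exact avoid_three (fun i hi => by have := hb i hi; omega) hn p hp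
      (contains_mono (by omega) hc)
  | succ m ih =>
    intro b hb hn p hp hc
    by_cases hm : 3 ≤ m
    · obtain ⟨c, hc1, hc2, hc3⟩ := word_structure hm hb hn
      have hs := prodD_signed (by omega) hc1
      obtain ⟨g2, g3⟩ := pats_good p hp
      apply ih c hc1 hc2 p hp
      rcases hc3 with h | h | h <;> rw [h] at hc
      · exact contains_down1 hs g2 hc
      · exact contains_down2 (by omega) hs g2 hc
      · exact contains_down3 (by omega) hs g3 hc
    · exact avoid_three (fun i hi => by have := hb i hi; omega) hn p hp
        (contains_mono (by omega) hc)



/-! ### Pattern-avoiding elements -/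

lemma build2 {n : ℕ} {w : Equiv.Perm ℤ} {p q : ℤ} {a b : ℤ} (h1 : 1 ≤ a) (h2 : a < b)
    (h3 : b ≤ n) (hs : (0 < w a ↔ 0 < p) ∧ (0 < w b ↔ 0 < q) ∧
      (|w a| < |w b| ↔ |p| < |q|) ∧ (|w b| < |w a| ↔ |q| < |p|)) :
    containsPat n w [p, q] := by
  obtain ⟨s1, s2, t1, t2⟩ := hs
  refine ⟨(![a, b] : Fin 2 → ℤ), ?_, ?_, ?_, ?_⟩
  · apply Fin.strictMono_iff_lt_succ.2
    intro i
    fin_cases i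
    exact h2
  · intro j
    change Fin 2 at j
    fin_cases j
    · exact ⟨h1, by change a ≤ (n : ℤ); omega⟩
    · exact ⟨by change 1 ≤ b; omega, h3⟩
  · intro j
    change Fin 2 at j
    fin_cases j
    exacts [s1, s2]
  · intro j j'
    change Fin 2 at j j'
    fin_cases j <;> fin_cases j'
    exacts [by simp, t1, t2, by simp]

lemma build3 {n : ℕ} {w : Equiv.Perm ℤ} {p q r : ℤ} {a b c : ℤ} (h1 : 1 ≤ a) (h2 : a < b)
    (h3 : b < c) (h4 : c ≤ n)
    (hs : (0 < w a ↔ 0 < p) ∧ (0 < w b ↔ 0 < q) ∧ (0 < w c ↔ 0 < r) ∧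
      (|w a| < |w b| ↔ |p| < |q|) ∧ (|w b| < |w a| ↔ |q| < |p|) ∧
      (|w a| < |w c| ↔ |p| < |r|) ∧ (|w c| < |w a| ↔ |r| < |p|) ∧
      (|w b| < |w c| ↔ |q| < |r|) ∧ (|w c| < |w b| ↔ |r| < |q|)) :
    containsPat n w [p, q, r] := by
  obtain ⟨s1, s2, s3, t1, t2, t3, t4, t5, t6⟩ := hs
  refine ⟨(![a, b, c] : Fin 3 → ℤ), ?_, ?_, ?_, ?_⟩
  · apply Fin.strictMono_iff_lt_succ.2
    intro i
    fin_cases i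
    exacts [h2, h3]
  · intro j
    change Fin 3 at j
    fin_cases j
    · exact ⟨h1, by change a ≤ (n : ℤ); omega⟩
    · exact ⟨by change 1 ≤ b; omega, by change b ≤ (n : ℤ); omega⟩
    · exact ⟨by change 1 ≤ c; omega, h4⟩
  · intro j
    change Fin 3 at j
    fin_cases j
    exacts [s1, s2, s3]
  · intro j j'
    change Fin 3 at j j'
    fin_cases j <;> fin_cases j'
    exacts [by simp, t1, t3, t2, by simp, t5, t4, t6, by simp]

lemma build4 {n : ℕ} {w : Equiv.Perm ℤ} {p q r s : ℤ} {a b c d : ℤ} (h1 : 1 ≤ a) (h2 : a < b)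
    (h3 : b < c) (h4 : c < d) (h5 : d ≤ n)
    (hs : ((0 < w a ↔ 0 < p) ∧ (0 < w b ↔ 0 < q) ∧ (0 < w c ↔ 0 < r) ∧ (0 < w d ↔ 0 < s)) ∧
      ((|w a| < |w b| ↔ |p| < |q|) ∧ (|w b| < |w a| ↔ |q| < |p|)) ∧
      ((|w a| < |w c| ↔ |p| < |r|) ∧ (|w c| < |w a| ↔ |r| < |p|)) ∧
      ((|w a| < |w d| ↔ |p| < |s|) ∧ (|w d| < |w a| ↔ |s| < |p|)) ∧
      ((|w b| < |w c| ↔ |q| < |r|) ∧ (|w c| < |w b| ↔ |r| < |q|)) ∧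
      ((|w b| < |w d| ↔ |q| < |s|) ∧ (|w d| < |w b| ↔ |s| < |q|)) ∧
      ((|w c| < |w d| ↔ |r| < |s|) ∧ (|w d| < |w c| ↔ |s| < |r|))) :
    containsPat n w [p, q, r, s] := by
  obtain ⟨⟨s1, s2, s3, s4⟩, ⟨t1, t2⟩, ⟨t3, t4⟩, ⟨t5, t6⟩, ⟨t7, t8⟩, ⟨t9, t10⟩, ⟨t11, t12⟩⟩ := hs
  refine ⟨(![a, b, c, d] : Fin 4 → ℤ), ?_, ?_, ?_, ?_⟩
  · apply Fin.strictMono_iff_lt_succ.2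
    intro i
    fin_cases i
    exacts [h2, h3, h4]
  · intro j
    change Fin 4 at j
    fin_cases j
    · exact ⟨h1, by change a ≤ (n : ℤ); omega⟩
    · exact ⟨by change 1 ≤ b; omega, by change b ≤ (n : ℤ); omega⟩
    · exact ⟨by change 1 ≤ c; omega, by change c ≤ (n : ℤ); omega⟩
    · exact ⟨by change 1 ≤ d; omega, h5⟩
  · intro j
    change Fin 4 at j
    fin_cases j
    exacts [s1, s2, s3, s4]
  · intro j j'
    change Fin 4 at j j'
    fin_cases j <;> fin_cases j'
    exacts [by simp, t1, t3, t5, t2, by simp, t7, t9, t4, t8, by simp, t11, t6, t10, t12, by simp]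

section FO
variable {n : ℕ} {w : Equiv.Perm ℤ}

lemma av_321 (hav : ∀ p ∈ pats, avoidsPat n w p) {a b c : ℤ} (h0 : 1 ≤ a) (h1 : a < b) (h2 : b < c) (h3 : c ≤ n)
    (k0 : 0 < w c) (k1 : w c < w b) (k2 : w b < w a) : False := by
  refine hav [3,2,1] (by simp [pats]) (build3 h0 h1 h2 h3 ?_)
  simp only [abs_eq_max_neg]
  omega

lemma av_3412 (hav : ∀ p ∈ pats, avoidsPat n w p) {a b c d : ℤ} (h0 : 1 ≤ a) (h1 : a < b) (h2 : b < c) (h3 : c < d) (h4 : d ≤ n)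
    (k0 : 0 < w c) (k1 : w c < w d) (k2 : w d < w a) (k3 : w a < w b) : False := by
  refine hav [3,4,1,2] (by simp [pats]) (build4 h0 h1 h2 h3 h4 ?_)
  simp only [abs_eq_max_neg]
  refine ⟨⟨?_, ?_, ?_, ?_⟩, ⟨?_, ?_⟩, ⟨?_, ?_⟩, ⟨?_, ?_⟩, ⟨?_, ?_⟩, ⟨?_, ?_⟩, ⟨?_, ?_⟩⟩ <;> omega

lemma av_32m1 (hav : ∀ p ∈ pats, avoidsPat n w p) {a b c : ℤ} (h0 : 1 ≤ a) (h1 : a < b) (h2 : b < c) (h3 : c ≤ n)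
    (k0 : 0 < -w c) (k1 : -w c < w b) (k2 : w b < w a) : False := by
  refine hav [3,2,-1] (by simp [pats]) (build3 h0 h1 h2 h3 ?_)
  simp only [abs_eq_max_neg]
  omega

lemma av_3m1m2 (hav : ∀ p ∈ pats, avoidsPat n w p) {a b c : ℤ} (h0 : 1 ≤ a) (h1 : a < b) (h2 : b < c) (h3 : c ≤ n)
    (k0 : 0 < -w b) (k1 : -w b < -w c) (k2 : -w c < w a) : False := by
  refine hav [3,-1,-2] (by simp [pats]) (build3 h0 h1 h2 h3 ?_)
  simp only [abs_eq_max_neg]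
  omega

lemma av_34m12 (hav : ∀ p ∈ pats, avoidsPat n w p) {a b c d : ℤ} (h0 : 1 ≤ a) (h1 : a < b) (h2 : b < c) (h3 : c < d) (h4 : d ≤ n)
    (k0 : 0 < -w c) (k1 : -w c < w d) (k2 : w d < w a) (k3 : w a < w b) : False := by
  refine hav [3,4,-1,2] (by simp [pats]) (build4 h0 h1 h2 h3 h4 ?_)
  simp only [abs_eq_max_neg]
  refine ⟨⟨?_, ?_, ?_, ?_⟩, ⟨?_, ?_⟩, ⟨?_, ?_⟩, ⟨?_, ?_⟩, ⟨?_, ?_⟩, ⟨?_, ?_⟩, ⟨?_, ?_⟩⟩ <;> omega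

lemma av_34m2m1 (hav : ∀ p ∈ pats, avoidsPat n w p) {a b c d : ℤ} (h0 : 1 ≤ a) (h1 : a < b) (h2 : b < c) (h3 : c < d) (h4 : d ≤ n)
    (k0 : 0 < -w d) (k1 : -w d < -w c) (k2 : -w c < w a) (k3 : w a < w b) : False := by
  refine hav [3,4,-2,-1] (by simp [pats]) (build4 h0 h1 h2 h3 h4 ?_)
  simp only [abs_eq_max_neg]
  refine ⟨⟨?_, ?_, ?_, ?_⟩, ⟨?_, ?_⟩, ⟨?_, ?_⟩, ⟨?_, ?_⟩, ⟨?_, ?_⟩, ⟨?_, ?_⟩, ⟨?_, ?_⟩⟩ <;> omega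

lemma av_m321 (hav : ∀ p ∈ pats, avoidsPat n w p) {a b c : ℤ} (h0 : 1 ≤ a) (h1 : a < b) (h2 : b < c) (h3 : c ≤ n)
    (k0 : 0 < w c) (k1 : w c < w b) (k2 : w b < -w a) : False := by
  refine hav [-3,2,1] (by simp [pats]) (build3 h0 h1 h2 h3 ?_)
  simp only [abs_eq_max_neg]
  omega

lemma av_m2m31 (hav : ∀ p ∈ pats, avoidsPat n w p) {a b c : ℤ} (h0 : 1 ≤ a) (h1 : a < b) (h2 : b < c) (h3 : c ≤ n)
    (k0 : 0 < w c) (k1 : w c < -w a) (k2 : -w a < -w b) : False := by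
  refine hav [-2,-3,1] (by simp [pats]) (build3 h0 h1 h2 h3 ?_)
  simp only [abs_eq_max_neg]
  omega

lemma av_m3412 (hav : ∀ p ∈ pats, avoidsPat n w p) {a b c d : ℤ} (h0 : 1 ≤ a) (h1 : a < b) (h2 : b < c) (h3 : c < d) (h4 : d ≤ n)
    (k0 : 0 < w c) (k1 : w c < w d) (k2 : w d < -w a) (k3 : -w a < w b) : False := by
  refine hav [-3,4,1,2] (by simp [pats]) (build4 h0 h1 h2 h3 h4 ?_)
  simp only [abs_eq_max_neg]
  refine ⟨⟨?_, ?_, ?_, ?_⟩, ⟨?_, ?_⟩, ⟨?_, ?_⟩, ⟨?_, ?_⟩, ⟨?_, ?_⟩, ⟨?_, ?_⟩, ⟨?_, ?_⟩⟩ <;> omega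

lemma av_m4m312 (hav : ∀ p ∈ pats, avoidsPat n w p) {a b c d : ℤ} (h0 : 1 ≤ a) (h1 : a < b) (h2 : b < c) (h3 : c < d) (h4 : d ≤ n)
    (k0 : 0 < w c) (k1 : w c < w d) (k2 : w d < -w b) (k3 : -w b < -w a) : False := by
  refine hav [-4,-3,1,2] (by simp [pats]) (build4 h0 h1 h2 h3 h4 ?_)
  simp only [abs_eq_max_neg]
  refine ⟨⟨?_, ?_, ?_, ?_⟩, ⟨?_, ?_⟩, ⟨?_, ?_⟩, ⟨?_, ?_⟩, ⟨?_, ?_⟩, ⟨?_, ?_⟩, ⟨?_, ?_⟩⟩ <;> omega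

lemma av_1m2 (hav : ∀ p ∈ pats, avoidsPat n w p) {a b : ℤ} (h0 : 1 ≤ a) (h1 : a < b) (h2 : b ≤ n)
    (k0 : 0 < w a) (k1 : w a < -w b) : False := by
  refine hav [1,-2] (by simp [pats]) (build2 h0 h1 h2 ?_)
  simp only [abs_eq_max_neg]
  omega

lemma av_3m21 (hav : ∀ p ∈ pats, avoidsPat n w p) {a b c : ℤ} (h0 : 1 ≤ a) (h1 : a < b) (h2 : b < c) (h3 : c ≤ n)
    (k0 : 0 < w c) (k1 : w c < -w b) (k2 : -w b < w a) : False := by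
  refine hav [3,-2,1] (by simp [pats]) (build3 h0 h1 h2 h3 ?_)
  simp only [abs_eq_max_neg]
  omega

lemma av_m32m1 (hav : ∀ p ∈ pats, avoidsPat n w p) {a b c : ℤ} (h0 : 1 ≤ a) (h1 : a < b) (h2 : b < c) (h3 : c ≤ n)
    (k0 : 0 < -w c) (k1 : -w c < w b) (k2 : w b < -w a) : False := by
  refine hav [-3,2,-1] (by simp [pats]) (build3 h0 h1 h2 h3 ?_)
  simp only [abs_eq_max_neg]
  omega

lemma av_m34m12 (hav : ∀ p ∈ pats, avoidsPat n w p) {a b c d : ℤ} (h0 : 1 ≤ a) (h1 : a < b) (h2 : b < c) (h3 : c < d) (h4 : d ≤ n)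
    (k0 : 0 < -w c) (k1 : -w c < w d) (k2 : w d < -w a) (k3 : -w a < w b) : False := by
  refine hav [-3,4,-1,2] (by simp [pats]) (build4 h0 h1 h2 h3 h4 ?_)
  simp only [abs_eq_max_neg]
  refine ⟨⟨?_, ?_, ?_, ?_⟩, ⟨?_, ?_⟩, ⟨?_, ?_⟩, ⟨?_, ?_⟩, ⟨?_, ?_⟩, ⟨?_, ?_⟩, ⟨?_, ?_⟩⟩ <;> omega

lemma av_m1m2m3 (hav : ∀ p ∈ pats, avoidsPat n w p) {a b c : ℤ} (h0 : 1 ≤ a) (h1 : a < b) (h2 : b < c) (h3 : c ≤ n)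
    (k0 : 0 < -w a) (k1 : -w a < -w b) (k2 : -w b < -w c) : False := by
  refine hav [-1,-2,-3] (by simp [pats]) (build3 h0 h1 h2 h3 ?_)
  simp only [abs_eq_max_neg]
  omega

lemma av_m1m3m2 (hav : ∀ p ∈ pats, avoidsPat n w p) {a b c : ℤ} (h0 : 1 ≤ a) (h1 : a < b) (h2 : b < c) (h3 : c ≤ n)
    (k0 : 0 < -w a) (k1 : -w a < -w c) (k2 : -w c < -w b) : False := by
  refine hav [-1,-3,-2] (by simp [pats]) (build3 h0 h1 h2 h3 ?_)
  simp only [abs_eq_max_neg]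
  omega

lemma av_m2m1m3 (hav : ∀ p ∈ pats, avoidsPat n w p) {a b c : ℤ} (h0 : 1 ≤ a) (h1 : a < b) (h2 : b < c) (h3 : c ≤ n)
    (k0 : 0 < -w b) (k1 : -w b < -w a) (k2 : -w a < -w c) : False := by
  refine hav [-2,-1,-3] (by simp [pats]) (build3 h0 h1 h2 h3 ?_)
  simp only [abs_eq_max_neg]
  omega

lemma av_m2m3m1 (hav : ∀ p ∈ pats, avoidsPat n w p) {a b c : ℤ} (h0 : 1 ≤ a) (h1 : a < b) (h2 : b < c) (h3 : c ≤ n)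
    (k0 : 0 < -w c) (k1 : -w c < -w a) (k2 : -w a < -w b) : False := by
  refine hav [-2,-3,-1] (by simp [pats]) (build3 h0 h1 h2 h3 ?_)
  simp only [abs_eq_max_neg]
  omega

lemma av_m3m1m2 (hav : ∀ p ∈ pats, avoidsPat n w p) {a b c : ℤ} (h0 : 1 ≤ a) (h1 : a < b) (h2 : b < c) (h3 : c ≤ n)
    (k0 : 0 < -w b) (k1 : -w b < -w c) (k2 : -w c < -w a) : False := by
  refine hav [-3,-1,-2] (by simp [pats]) (build3 h0 h1 h2 h3 ?_)
  simp only [abs_eq_max_neg]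
  omega

lemma av_m3m2m1 (hav : ∀ p ∈ pats, avoidsPat n w p) {a b c : ℤ} (h0 : 1 ≤ a) (h1 : a < b) (h2 : b < c) (h3 : c ≤ n)
    (k0 : 0 < -w c) (k1 : -w c < -w b) (k2 : -w b < -w a) : False := by
  refine hav [-3,-2,-1] (by simp [pats]) (build3 h0 h1 h2 h3 ?_)
  simp only [abs_eq_max_neg]
  omega

end FO



lemma signed_D {n : ℕ} {w : Equiv.Perm ℤ} (hw : IsSignedPerm n w) (a b : ℤ) (ha : 1 ≤ a)
    (hb : 1 ≤ b) : (a = b ∧ w a = w b) ∨ (a ≠ b ∧ w a ≠ w b ∧ w a ≠ -w b) := by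
  by_cases h : a = b
  · exact Or.inl ⟨h, by rw [h]⟩
  · refine Or.inr ⟨h, fun e => h (w.injective e), fun e => ?_⟩
    rw [← hw.1] at e
    have := w.injective e
    omega

lemma signed_F {n : ℕ} {w : Equiv.Perm ℤ} (hw : IsSignedPerm n w) (a : ℤ) (ha : 1 ≤ a)
    (hb : a ≤ n) : -(n : ℤ) ≤ w a ∧ w a ≤ n ∧ w a ≠ 0 := by
  have h1 := signed_abs_le hw (x := a) (by rw [abs_of_nonneg (by omega)]; omega)
  have h2 := signed_ne_zero hw (x := a) (by omega)
  rw [abs_le] at h1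
  exact ⟨h1.1, h1.2, h2⟩

lemma signed_pos {n : ℕ} {w : Equiv.Perm ℤ} (hw : IsSignedPerm n w) (v : ℤ) (ha : 1 ≤ v)
    (hb : v ≤ n) : ∃ p : ℤ, 1 ≤ p ∧ p ≤ n ∧ (w p = v ∨ w p = -v) := by
  obtain ⟨x, rfl⟩ := w.surjective v
  have hx : |x| ≤ n := by
    by_contra h
    push Not at h
    have := hw.2 x h
    rw [this] at ha hb
    rw [abs_of_nonneg (by omega)] at h
    omega
  have h0 : x ≠ 0 := by
    rintro rfl
    have := hw.1 0
    simp at this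
    omega
  rw [abs_le] at hx
  by_cases h : 0 < x
  · exact ⟨x, by omega, by omega, Or.inl rfl⟩
  · exact ⟨-x, by omega, by omega, Or.inr (hw.1 x)⟩

/-- The number of negative entries is not one. -/
def NegCond (w : Equiv.Perm ℤ) : Prop := ∀ x > 0, w x < 0 → ∃ y > 0, y ≠ x ∧ w y < 0

lemma negCond_of_typeD {n : ℕ} {w : Equiv.Perm ℤ} (hw : IsTypeD n w) : NegCond w := by
  intro x hx hneg
  by_contra h
  push Not at h
  have hxn : x ≤ n := by
    by_contra hc
    have := hw.1.2 x (by rw [abs_of_nonneg (by omega)]; omega)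
    omega
  have : (Finset.Icc (1 : ℤ) n).filter (fun x => w x < 0) = {x} := by
    ext y
    simp only [Finset.mem_filter, Finset.mem_Icc, Finset.mem_singleton]
    constructor
    · rintro ⟨⟨h1, h2⟩, h3⟩
      by_contra hne
      have := h y (by omega) hne
      omega
    · rintro rfl
      exact ⟨⟨by omega, hxn⟩, hneg⟩
  have h2 := hw.2
  rw [this] at h2
  simp at h2

lemma no_three {n : ℕ} {w : Equiv.Perm ℤ} (hw : IsSignedPerm n w)
    (hav : ∀ p ∈ pats, avoidsPat n w p) {a b c : ℤ} (h0 : 1 ≤ a) (h1 : a < b) (h2 : b < c)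
    (h3 : c ≤ n) (ka : w a < 0) (kb : w b < 0) (kc : w c < 0) : False := by
  have d1 := signed_D hw a b (by omega) (by omega)
  have d2 := signed_D hw a c (by omega) (by omega)
  have d3 := signed_D hw b c (by omega) (by omega)
  rcases lt_or_gt_of_ne (show w a ≠ w b by omega) with e1 | e1 <;>
  rcases lt_or_gt_of_ne (show w a ≠ w c by omega) with e2 | e2 <;>
  rcases lt_or_gt_of_ne (show w b ≠ w c by omega) with e3 | e3
  · exact av_m3m2m1 hav h0 h1 h2 h3 (by omega) (by omega) (by omega)
  · exact av_m3m1m2 hav h0 h1 h2 h3 (by omega) (by omega) (by omega)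
  · omega
  · exact av_m2m1m3 hav h0 h1 h2 h3 (by omega) (by omega) (by omega)
  · exact av_m2m3m1 hav h0 h1 h2 h3 (by omega) (by omega) (by omega)
  · omega
  · exact av_m1m3m2 hav h0 h1 h2 h3 (by omega) (by omega) (by omega)
  · exact av_m1m2m3 hav h0 h1 h2 h3 (by omega) (by omega) (by omega)

lemma main_neg {m : ℕ} (hm : 2 ≤ m) {w : Equiv.Perm ℤ} (hw : IsSignedPerm (m+1) w)
    (hn : NegCond w) (hav : ∀ p ∈ pats, avoidsPat (m+1) w p) (p : ℤ) (hp1 : 1 ≤ p)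
    (hp2 : p ≤ m + 1) (hp : w p = -(m+1)) :
    w (m+1) = m ∨ (m = 2 ∧ w 1 = -3 ∧ w 2 = -2 ∧ w 3 = 1) := by
  have F := signed_F hw
  have D := signed_D hw
  have T : ∀ a b c : ℤ, 1 ≤ a → a < b → b < c → c ≤ m + 1 → w a < 0 → w b < 0 → w c < 0 → False :=
    fun a b c h0 h1 h2 h3 => no_three hw hav h0 h1 h2 (by omega)
  push_cast at F
  have early : ∀ a, 1 ≤ a → a < p → w a < 0 := by
    intro a h1 h2
    by_contra h
    have := F a h1 (by omega)
    have := D a p h1 hp1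
    exact av_1m2 hav h1 h2 (by omega) (by omega) (by omega)
  obtain ⟨r, hr0, hrp, hr⟩ := hn p (by omega) (by omega)
  have hrN : r ≤ m + 1 := by
    by_contra hc
    have := hw.2 r (by rw [abs_of_nonneg (by omega)]; push_cast; omega)
    omega
  obtain ⟨M, hM1, hM2, hM⟩ := signed_pos hw (m : ℤ) (by omega) (by omega)
  have hM2' : M ≤ m + 1 := by omega
  have fq := F (m+1) (by omega) (by omega)
  have dqp := D (m+1) p (by omega) (by omega)
  have dqM := D (m+1) M (by omega) (by omega)
  have dpM := D p M (by omega) (by omega)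
  have drM := D r M (by omega) (by omega)
  have dqr := D (m+1) r (by omega) (by omega)
  have dpr := D p r (by omega) (by omega)
  by_cases hq : w (m+1) = m
  · exact Or.inl hq
  by_cases hrp' : r < p
  · have hp2 : p = 2 ∧ r = 1 := by
      by_contra hc
      by_cases h1 : r = 1
      · exact T 1 2 p (by omega) (by omega) (by omega) (by omega) (early _ (by omega) (by omega))
          (early _ (by omega) (by omega)) (by omega)
      · exact T 1 r p (by omega) (by omega) (by omega) (by omega) (early _ (by omega) (by omega))
          hr (by omega)
    have aft : ∀ c, p < c → c ≤ m + 1 → 0 < w c := by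
      intro c h1 h2
      by_contra hc
      have := F c (by omega) h2
      exact T r p c (by omega) (by omega) (by omega) h2 hr (by omega) (by omega)
    have q0 := aft (m+1) (by omega) (by omega)
    have q1 : ¬ (w (m+1) < - w r) := fun h =>
      av_m2m31 hav (a := r) (b := p) (c := m+1) (by omega) (by omega) (by omega) (by omega)
        (by omega) (by omega) (by have := F r (by omega) (by omega); omega)
    have hMr : M ≠ r := by omega
    have hMp : M ≠ p := by omega
    have := aft M (by omega) (by omega)
    exact (av_m321 hav (a := p) (b := M) (c := m+1) (by omega) (by omega) (by omega) (by omega)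
        (by omega) (by omega) (by omega)).elim
  · have hp1' : p = 1 := by
      by_contra hc
      exact T 1 p r (by omega) (by omega) (by omega) hrN (early _ (by omega) (by omega))
        (by omega) hr
    have oth : ∀ c, 1 ≤ c → c ≠ p → c ≠ r → c ≤ m + 1 → 0 < w c := by
      intro c h0 h1 h2 h3
      by_contra hc
      have := F c (by omega) h3
      rcases lt_or_gt_of_ne h2 with h | h
      · exact T p c r (by omega) (by omega) (by omega) hrN (by omega) (by omega) hr
      · exact T p r c (by omega) (by omega) (by omega) h3 (by omega) hr (by omega)
    have r1m2 : ∀ c, p < c → c < r → - w r < w c := by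
      intro c h1 h2
      have := oth c (by omega) (by omega) (by omega) (by omega)
      have := D c r (by omega) (by omega)
      by_contra hc
      exact av_1m2 hav (a := c) (b := r) (by omega) h2 (by omega) (by omega) (by omega)
    by_cases hrN' : r = m + 1
    · have h2 := r1m2 2 (by omega) (by omega)
      have := F 2 (by omega) (by omega)
      have := D 2 p (by omega) (by omega)
      exact (av_m32m1 hav (a := p) (b := 2) (c := r) (by omega) (by omega) (by omega) (by omega)
        (by omega) (by omega) (by omega)).elim
    · have q0 := oth (m+1) (by omega) (by omega) (by omega) (by omega)
      by_cases hMr : M = r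
      · have hr2 : r = 2 := by
          by_contra hc
          have := r1m2 2 (by omega) (by omega)
          have := F 2 (by omega) (by omega)
          have := D 2 p (by omega) (by omega)
          omega
        by_cases hm2 : m = 2
        · right
          have ep : w p = w 1 := by rw [hp1']
          have er : w r = w 2 := by rw [hr2]
          have eq : w (m+1) = w 3 := by rw [hm2]; norm_num
          refine ⟨hm2, ?_, ?_, ?_⟩ <;> omega
        · have x0 := oth 3 (by omega) (by omega) (by omega) (by omega)
          have := F 3 (by omega) (by omega)
          have := D 3 p (by omega) (by omega)
          have := D 3 M (by omega) (by omega)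
          have := D 3 (m+1) (by omega) (by omega)
          by_cases hx : w 3 < w (m+1)
          · exact (av_m4m312 hav (a := p) (b := r) (c := 3) (d := m+1) (by omega) (by omega)
              (by omega) (by omega) (by omega) (by omega) (by omega) (by omega) (by omega)).elim
          · exact (av_m321 hav (a := p) (b := 3) (c := m+1) (by omega) (by omega)
              (by omega) (by omega) (by omega) (by omega) (by omega)).elim
      · have := oth M (by omega) (by omega) (by omega) (by omega)
        exact (av_m321 hav (a := p) (b := M) (c := m+1) (by omega) (by omega)
              (by omega) (by omega) (by omega) (by omega) (by omega)).elim

lemma main_pos {m : ℕ} (hm : 2 ≤ m) {w : Equiv.Perm ℤ} (hw : IsSignedPerm (m+1) w)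
    (hav : ∀ p ∈ pats, avoidsPat (m+1) w p) (p : ℤ) (hp1 : 1 ≤ p)
    (hp2 : p < m) (hp : w p = m+1) :
    w (m+1) = m ∨ (m = 2 ∧ w 1 = 3 ∧ w 2 = -2 ∧ w 3 = -1) := by
  have F := signed_F hw
  have D := signed_D hw
  push_cast at F
  obtain ⟨M, hM1, hM2, hM⟩ := signed_pos hw (m : ℤ) (by omega) (by omega)
  have hM2' : M ≤ m + 1 := by omega
  have fq := F (m+1) (by omega) (by omega)
  have fx := F m (by omega) (by omega)
  have dqp := D (m+1) p (by omega) (by omega)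
  have dqM := D (m+1) M (by omega) (by omega)
  have dpM := D p M (by omega) (by omega)
  have dxM := D m M (by omega) (by omega)
  have dxp := D m p (by omega) (by omega)
  have dxq := D m (m+1) (by omega) (by omega)
  by_cases hq : w (m+1) = m
  · exact Or.inl hq
  rcases lt_or_gt_of_ne fq.2.2 with q0 | q0
  · rcases lt_or_gt_of_ne fx.2.2 with x0 | x0
    · by_cases hx : - w m < - w (m+1)
      · exact (av_3m1m2 hav (a := p) (b := m) (c := m+1) (by omega) (by omega)
              (by omega) (by omega) (by omega) (by omega) (by omega)).elim
      · have key : ∀ y : ℤ, 1 ≤ y → y < m → y ≠ p → False := by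
          intro y h1 h2 h3
          have fy := F y h1 (by omega)
          have d1 := D y m (by omega) (by omega)
          have d2 := D y p (by omega) (by omega)
          have y0 : 0 < w y := by
            by_contra hc
            exact no_three hw hav (a := y) (b := m) (c := m+1) (by omega) (by omega)
              (by omega) (by omega) (by omega) (by omega) (by omega)
          have y1 : - w m < w y := by
            by_contra hc
            exact av_1m2 hav (a := y) (b := m) (by omega) (by omega)
              (by omega) (by omega) (by omega)
          rcases lt_or_gt_of_ne h3 with h | h
          · exact av_34m2m1 hav (a := y) (b := p) (c := m) (d := m+1) (by omega) (by omega)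
              (by omega) (by omega) (by omega) (by omega) (by omega) (by omega) (by omega)
          · exact av_32m1 hav (a := p) (b := y) (c := m+1) (by omega) (by omega)
              (by omega) (by omega) (by omega) (by omega) (by omega)
        by_cases hm2 : m = 2
        · right
          have hp1' : p = 1 := by omega
          have ep : w p = w 1 := by rw [hp1']
          have er : w m = w 2 := by rw [hm2]; norm_num
          have eq : w (m+1) = w 3 := by rw [hm2]; norm_num
          refine ⟨hm2, ?_, ?_, ?_⟩ <;> omega
        · by_cases h1 : p = 1
          · exact (key 2 (by omega) (by omega) (by omega)).elim
          · exact (key 1 (by omega) (by omega) (by omega)).elim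
    · exfalso
      by_cases hx : w m < - w (m+1)
      · exact av_1m2 hav (a := m) (b := m+1) (by omega) (by omega)
              (by omega) (by omega) (by omega)
      · exact av_32m1 hav (a := p) (b := m) (c := m+1) (by omega) (by omega)
              (by omega) (by omega) (by omega) (by omega) (by omega)
  · exfalso
    by_cases hMp : p < M
    · rcases hM with hM | hM
      · exact av_321 hav (a := p) (b := M) (c := m+1) (by omega) (by omega)
              (by omega) (by omega) (by omega) (by omega) (by omega)
      · exact av_3m21 hav (a := p) (b := M) (c := m+1) (by omega) (by omega)
              (by omega) (by omega) (by omega) (by omega) (by omega)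
    · rcases lt_or_gt_of_ne fx.2.2 with x0 | x0
      · by_cases hx : - w m < w (m+1)
        · rcases hM with hM | hM
          · exact av_34m12 hav (a := M) (b := p) (c := m) (d := m+1) (by omega) (by omega)
              (by omega) (by omega) (by omega) (by omega) (by omega) (by omega) (by omega)
          · exact av_m34m12 hav (a := M) (b := p) (c := m) (d := m+1) (by omega) (by omega)
              (by omega) (by omega) (by omega) (by omega) (by omega) (by omega) (by omega)
        · exact av_3m21 hav (a := p) (b := m) (c := m+1) (by omega) (by omega)
              (by omega) (by omega) (by omega) (by omega) (by omega)
      · by_cases hx : w m < w (m+1)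
        · rcases hM with hM | hM
          · exact av_3412 hav (a := M) (b := p) (c := m) (d := m+1) (by omega) (by omega)
              (by omega) (by omega) (by omega) (by omega) (by omega) (by omega) (by omega)
          · exact av_m3412 hav (a := M) (b := p) (c := m) (d := m+1) (by omega) (by omega)
              (by omega) (by omega) (by omega) (by omega) (by omega) (by omega) (by omega)
        · exact av_321 hav (a := p) (b := m) (c := m+1) (by omega) (by omega)
              (by omega) (by omega) (by omega) (by omega) (by omega)

lemma main_cases {m : ℕ} (hm : 2 ≤ m) {w : Equiv.Perm ℤ} (hw : IsSignedPerm (m+1) w)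
    (hn : NegCond w) (hav : ∀ p ∈ pats, avoidsPat (m+1) w p) :
    w (m+1) = m+1 ∨ w m = m+1 ∨ w (m+1) = m ∨ (m = 2 ∧ w 1 = 3 ∧ w 2 = -2 ∧ w 3 = -1) ∨
      (m = 2 ∧ w 1 = -3 ∧ w 2 = -2 ∧ w 3 = 1) := by
  obtain ⟨p, hp1, hp2, hp⟩ := signed_pos hw (m+1 : ℤ) (by omega) (by omega)
  push_cast at hp2
  rcases hp with hp | hp
  · by_cases h1 : p = m + 1
    · subst h1; exact Or.inl hp
    by_cases h2 : p = m
    · subst h2; exact Or.inr (Or.inl hp)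
    rcases main_pos hm hw hav p hp1 (by omega) hp with h | h
    · exact Or.inr (Or.inr (Or.inl h))
    · exact Or.inr (Or.inr (Or.inr (Or.inl h)))
  · rcases main_neg hm hw hn hav p hp1 hp2 hp with h | h
    · exact Or.inr (Or.inr (Or.inl h))
    · exact Or.inr (Or.inr (Or.inr (Or.inr h)))

lemma signed_ext {n : ℕ} {u w : Equiv.Perm ℤ} (hu : IsSignedPerm n u) (hw : IsSignedPerm n w)
    (h : ∀ a : ℤ, 1 ≤ a → a ≤ n → u a = w a) : u = w := by
  ext x
  by_cases hx : (n : ℤ) < |x|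
  · rw [hu.2 x hx, hw.2 x hx]
  rw [not_lt, abs_le] at hx
  rcases lt_trichotomy x 0 with h0 | h0 | h0
  · have := h (-x) (by omega) (by omega)
    rw [hu.1, hw.1] at this
    omega
  · subst h0
    have h1 := hu.1 0
    have h2 := hw.1 0
    simp at h1 h2
    omega
  · exact h x (by omega) (by omega)

lemma signed_down {m : ℕ} {w : Equiv.Perm ℤ} (hw : IsSignedPerm (m+1) w) (h : w (m+1) = m+1) :
    IsSignedPerm m w := by
  refine ⟨hw.1, fun x hx => ?_⟩
  by_cases hx' : ((m+1 : ℕ) : ℤ) < |x|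
  · exact hw.2 x hx'
  have : |x| = m + 1 := by push_cast at hx'; omega
  rcases (abs_eq (by omega)).1 this with rfl | rfl
  · exact h
  · rw [hw.1, h]

lemma sD_signed {m : ℕ} (hm : 1 ≤ m) : IsSignedPerm (m+1) (sD m) := by
  refine ⟨fun x => sD_neg m x, fun x hx => ?_⟩
  have := sD_spec m x
  push_cast at hx
  rw [abs_eq_max_neg] at hx
  omega

lemma IsSignedPerm.mul {n : ℕ} {u v : Equiv.Perm ℤ} (hu : IsSignedPerm n u)
    (hv : IsSignedPerm n v) : IsSignedPerm n (u * v) := by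
  refine ⟨fun x => ?_, fun x hx => ?_⟩
  · simp only [Equiv.Perm.mul_apply, hv.1, hu.1]
  · simp only [Equiv.Perm.mul_apply]
    rw [hv.2 x hx, hu.2 x hx]

theorem word_of_avoid (n : ℕ) : ∀ w : Equiv.Perm ℤ, IsSignedPerm n w → NegCond w →
    (∀ p ∈ pats, avoidsPat n w p) → ∃ b, IsWordBD n b ∧ b.Nodup ∧ prodD b = w := by
  induction n with
  | zero =>
    intro w hw hn hav
    refine ⟨[], by intro i hi; simp at hi, List.nodup_nil, ?_⟩
    refine signed_ext (n := 0) ⟨by simp, by simp⟩ hw ?_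
    intro a h1 h2
    push_cast at h2
    omega
  | succ m ih =>
    intro w hw hn hav
    rcases Nat.lt_or_ge m 2 with hm | hm
    · have hbeyond : ∀ y : ℤ, (m : ℤ) + 1 < y → w y = y := fun y hy =>
        hw.2 y (by rw [abs_of_nonneg (by omega)]; push_cast; omega)
      have F := signed_F hw
      have D := signed_D hw
      rcases (show m = 0 ∨ m = 1 by omega) with rfl | rfl
      · refine ⟨[], by intro i hi; simp at hi, List.nodup_nil, ?_⟩
        refine signed_ext (n := 1) ⟨by simp, by simp⟩ hw ?_
        intro a h1 h2
        have : a = 1 := by push_cast at h2; omega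
        subst this
        have f1 := F 1 (by omega) (by norm_num)
        norm_num at f1
        by_cases hneg : w 1 < 0
        · obtain ⟨y, y0, y1, y2⟩ := hn 1 (by omega) hneg
          have := hbeyond y (by norm_num; omega)
          omega
        · simp; omega
      · have f1 := F 1 (by omega) (by norm_num)
        have f2 := F 2 (by omega) (by norm_num)
        have d := D 1 2 (by omega) (by omega)
        push_cast at f1 f2
        have n1 : w 1 < 0 → w 2 < 0 := by
          intro h
          obtain ⟨y, y0, y1, y2⟩ := hn 1 (by omega) h
          by_cases hy : y = 2
          · rwa [hy] at y2
          · have := hbeyond y (by norm_num; omega)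
            omega
        have n2 : w 2 < 0 → w 1 < 0 := by
          intro h
          obtain ⟨y, y0, y1, y2⟩ := hn 2 (by omega) h
          by_cases hy : y = 1
          · rwa [hy] at y2
          · have := hbeyond y (by norm_num; omega)
            omega
        have fin : ∀ b : List ℕ, IsWordBD 2 b → prodD b 1 = w 1 → prodD b 2 = w 2 →
            prodD b = w := by
          intro b hb e1 e2
          refine signed_ext (prodD_signed (le_refl 2) hb) hw ?_
          intro a h1 h2
          push_cast at h2
          rcases (show a = 1 ∨ a = 2 by omega) with rfl | rfl
          · exact e1
          · exact e2
        have cases4 : (w 1 = 1 ∧ w 2 = 2) ∨ (w 1 = 2 ∧ w 2 = 1) ∨ (w 1 = -2 ∧ w 2 = -1) ∨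
            (w 1 = -1 ∧ w 2 = -2) := by omega
        rcases cases4 with ⟨e1, e2⟩ | ⟨e1, e2⟩ | ⟨e1, e2⟩ | ⟨e1, e2⟩
        · have hb : IsWordBD 2 [] := by intro i hi; simp at hi
          exact ⟨_, hb, by simp, fin _ hb (by rw [e1]; decide) (by rw [e2]; decide)⟩
        · have hb : IsWordBD 2 [1] := by intro i hi; simp at hi; omega
          exact ⟨_, hb, by simp, fin _ hb (by rw [e1]; decide) (by rw [e2]; decide)⟩
        · have hb : IsWordBD 2 [0] := by intro i hi; simp at hi; omega
          exact ⟨_, hb, by simp, fin _ hb (by rw [e1]; decide) (by rw [e2]; decide)⟩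
        · have hb : IsWordBD 2 [0, 1] := by intro i hi; simp at hi; omega
          exact ⟨_, hb, by simp, fin _ hb (by rw [e1]; decide) (by rw [e2]; decide)⟩
    · have up : ∀ c, IsWordBD m c → IsWordBD (m+1) c := fun c hc i hi => by
        have := hc i hi; omega
      have nin : ∀ c, IsWordBD m c → m ∉ c := fun c hc hi => by
        have := hc m hi; omega
      have hs := sD_signed (m := m) (by omega)
      have sneg : ∀ x, sD m x < 0 ↔ x < 0 := by
        intro x
        have := sD_spec m x
        omega
      rcases main_cases hm hw hn hav with h | h | h | ⟨rfl, e1, e2, e3⟩ | ⟨rfl, e1, e2, e3⟩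
      · obtain ⟨b, b1, b2, b3⟩ := ih w (signed_down hw h) hn
          (fun p hp hc => hav p hp (contains_mono (by omega) hc))
        exact ⟨b, up b b1, b2, b3⟩
      · have hsN : sD m (m+1) = m := by have := sD_spec m (m+1); omega
        have eq : w = (w * sD m) * sD m := by rw [mul_assoc, sD_mul_self, mul_one]
        obtain ⟨b, b1, b2, b3⟩ := ih (w * sD m)
          (signed_down (hw.mul hs) (by rw [Equiv.Perm.mul_apply, hsN, h])) (by
            intro x hx hxn
            simp only [Equiv.Perm.mul_apply] at hxn ⊢
            obtain ⟨y, y0, y1, y2⟩ := hn (sD m x) ((sD_sign (by omega) x).2 hx) hxn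
            refine ⟨sD m y, (sD_sign (by omega) y).2 y0, ?_, by rw [sD_sD]; exact y2⟩
            rintro rfl
            exact y1 (sD_sD m y).symm)
          (fun p hp hc => hav p hp (by rw [eq]; exact contains_up2 (by omega) hc))
        refine ⟨b ++ [m], ?_, ?_, ?_⟩
        · intro i hi
          rcases List.mem_append.1 hi with hi | hi
          · exact up b b1 i hi
          · simp at hi; omega
        · rw [List.nodup_append]
          refine ⟨b2, by simp, ?_⟩
          intro a ha c hc
          simp at hc
          rintro rfl
          exact nin b b1 (hc ▸ ha)
        · rw [prodD_append, b3]
          simp only [prodD_cons, prodD_nil, mul_one]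
          exact eq.symm
      · have hsN : sD m m = m + 1 := by have := sD_spec m m; omega
        have eq : w = sD m * (sD m * w) := by rw [← mul_assoc, sD_mul_self, one_mul]
        have hsig := signed_down (hs.mul hw) (by rw [Equiv.Perm.mul_apply, h, hsN])
        obtain ⟨b, b1, b2, b3⟩ := ih (sD m * w) hsig (by
            intro x hx hxn
            simp only [Equiv.Perm.mul_apply] at hxn ⊢
            rw [sneg] at hxn
            obtain ⟨y, y0, y1, y2⟩ := hn x hx hxn
            exact ⟨y, y0, y1, by rw [sneg]; exact y2⟩)
          (fun p hp hc => hav p hp (by rw [eq]; exact contains_up3 (by omega) hsig hc))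
        refine ⟨m :: b, ?_, ?_, ?_⟩
        · intro i hi
          rcases List.mem_cons.1 hi with hi | hi
          · omega
          · exact up b b1 i hi
        · exact List.nodup_cons.2 ⟨nin b b1, b2⟩
        · rw [prodD_cons, b3]
          exact eq.symm
      · have hb : IsWordBD 3 [0, 2, 1] := by intro i hi; simp at hi; omega
        refine ⟨_, hb, by simp, signed_ext (prodD_signed (by omega) hb) hw ?_⟩
        intro a h1 h2
        push_cast at h2
        rcases (show a = 1 ∨ a = 2 ∨ a = 3 by omega) with rfl | rfl | rfl
        · rw [e1]; decide
        · rw [e2]; decide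
        · rw [e3]; decide
      · have hb : IsWordBD 3 [1, 2, 0] := by intro i hi; simp at hi; omega
        refine ⟨_, hb, by simp, signed_ext (prodD_signed (by omega) hb) hw ?_⟩
        intro a h1 h2
        push_cast at h2
        rcases (show a = 1 ∨ a = 2 ∨ a = 3 by omega) with rfl | rfl | rfl
        · rw [e1]; decide
        · rw [e2]; decide
        · rw [e3]; decide

lemma boolean_iff {n : ℕ} {w : Equiv.Perm ℤ} (hw : IsTypeD n w) :
    BooleanD n w ↔ ∀ p ∈ pats, avoidsPat n w p := by
  constructor
  · intro h
    obtain ⟨b, b1, b2, rfl⟩ := nodup_of_boolean h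
    exact avoid_of_nodup n b b1 b2
  · intro h
    obtain ⟨b, b1, b2, rfl⟩ := word_of_avoid n w hw.1 (negCond_of_typeD hw) h
    exact boolean_of_nodup b1 b2

theorem stmt18 (n : ℕ) (w : Equiv.Perm ℤ) (hw : IsTypeD n w) :
    BooleanD n w ↔
      (avoidsPat n w [-1,-2,-3] ∧ avoidsPat n w [-1,-3,-2] ∧
       avoidsPat n w [-2,-1,-3] ∧ avoidsPat n w [-2,-3,-1] ∧
       avoidsPat n w [-3,-1,-2] ∧ avoidsPat n w [-3,-2,-1] ∧
       avoidsPat n w [3,2,1] ∧ avoidsPat n w [3,4,1,2] ∧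
       avoidsPat n w [3,2,-1] ∧ avoidsPat n w [3,-1,-2] ∧
       avoidsPat n w [3,4,-1,2] ∧ avoidsPat n w [3,4,-2,-1] ∧
       avoidsPat n w [-3,2,1] ∧ avoidsPat n w [-2,-3,1] ∧
       avoidsPat n w [-3,4,1,2] ∧ avoidsPat n w [-4,-3,1,2] ∧
       avoidsPat n w [1,-2] ∧ avoidsPat n w [3,-2,1] ∧
       avoidsPat n w [-3,2,-1] ∧ avoidsPat n w [-3,4,-1,2]) := by
  rw [boolean_iff hw]
  simp [pats]

end Paper
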